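/- Up to isomorphism, there are exactly 2 non-orientable vertex-transitive equivelar maps of Schläfli type {3,7} with Euler characteristic −2 that are neither regular nor chiral. -/

import Mathlib

/-- A map: a finite nonempty set of flags with three fixed-point-free involutions
`s0, s1, s2` such that `s0 * s2` is also a fixed-point-free involution and the
group generated by them acts transitively on the flags. -/
structure CMap (F : Type) [Fintype F] where
  nonempty : Nonempty F
  s0 : Equiv.Perm F
  s1 : Equiv.Perm F
  s2 : Equiv.Perm F
  invol0 : s0 * s0 = 1
  invol1 : s1 * s1 = 1
  invol2 : s2 * s2 = 1
  fpf0 : ∀ x, s0 x ≠ x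
  fpf1 : ∀ x, s1 x ≠ x
  fpf2 : ∀ x, s2 x ≠ x
  invol02 : (s0 * s2) * (s0 * s2) = 1
  fpf02 : ∀ x, s0 (s2 x) ≠ x
  conn : ∀ x y : F, ∃ g ∈ Subgroup.closure ({s0, s1, s2} : Set (Equiv.Perm F)), g x = y

namespace CMap

variable {F : Type} [Fintype F]

/-- The automorphism group of a map: all permutations of the flags commuting
with each of `s0, s1, s2`. -/
def aut (M : CMap F) : Subgroup (Equiv.Perm F) :=
  Subgroup.centralizer {M.s0, M.s1, M.s2}

/-- The vertex containing a flag `x`: the orbit of `x` under `⟨s1, s2⟩`. -/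
def vertexOf (M : CMap F) (x : F) : Set F :=
  MulAction.orbit (Subgroup.closure ({M.s1, M.s2} : Set (Equiv.Perm F))) x

/-- The edge containing a flag `x`: the orbit of `x` under `⟨s0, s2⟩`. -/
def edgeOf (M : CMap F) (x : F) : Set F :=
  MulAction.orbit (Subgroup.closure ({M.s0, M.s2} : Set (Equiv.Perm F))) x

/-- The face containing a flag `x`: the orbit of `x` under `⟨s0, s1⟩`. -/
def faceOf (M : CMap F) (x : F) : Set F :=
  MulAction.orbit (Subgroup.closure ({M.s0, M.s1} : Set (Equiv.Perm F))) x

/-- The orbit of a flag under the automorphism group. -/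
def flagOrbit (M : CMap F) (x : F) : Set F :=
  MulAction.orbit M.aut x

noncomputable def numVertices (M : CMap F) : ℕ := Nat.card (Set.range M.vertexOf)

noncomputable def numEdges (M : CMap F) : ℕ := Nat.card (Set.range M.edgeOf)

noncomputable def numFaces (M : CMap F) : ℕ := Nat.card (Set.range M.faceOf)

/-- The Euler characteristic `V - E + F` of a map. -/
noncomputable def euler (M : CMap F) : ℤ :=
  (M.numVertices : ℤ) - (M.numEdges : ℤ) + (M.numFaces : ℤ)

/-- The number of orbits of the automorphism group on flags. -/
noncomputable def numFlagOrbits (M : CMap F) : ℕ := Nat.card (Set.range M.flagOrbit)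

/-- `M` is a `k`-orbit map if its automorphism group has exactly `k` orbits on flags. -/
def IsKOrbit (M : CMap F) (k : ℕ) : Prop := M.numFlagOrbits = k

/-- A map is regular if it is a 1-orbit map. -/
def IsRegular (M : CMap F) : Prop := M.IsKOrbit 1

/-- A map is chiral if it is a 2-orbit map in which every flag lies in a
different automorphism orbit from each of its images under `s0, s1, s2`. -/
def IsChiral (M : CMap F) : Prop :=
  M.IsKOrbit 2 ∧ ∀ x : F,
    M.s0 x ∉ M.flagOrbit x ∧ M.s1 x ∉ M.flagOrbit x ∧ M.s2 x ∉ M.flagOrbit x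

/-- A map is vertex-transitive if its automorphism group acts transitively on vertices. -/
def VertexTransitive (M : CMap F) : Prop :=
  ∀ x y : F, ∃ g ∈ M.aut, M.vertexOf (g x) = M.vertexOf y

/-- A map is edge-transitive if its automorphism group acts transitively on edges. -/
def EdgeTransitive (M : CMap F) : Prop :=
  ∀ x y : F, ∃ g ∈ M.aut, M.edgeOf (g x) = M.edgeOf y

/-- `M` is equivelar of Schläfli type `{p, q}`: every face has exactly `2p` flags
and every vertex has exactly `2q` flags. -/
def Equivelar (M : CMap F) (p q : ℕ) : Prop :=
  (∀ x : F, Nat.card (M.faceOf x) = 2 * p) ∧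
  (∀ x : F, Nat.card (M.vertexOf x) = 2 * q)

/-- A map is orientable if the flags can be partitioned into two classes so that
each of `s0, s1, s2` maps each class into the other. -/
def Orientable (M : CMap F) : Prop :=
  ∃ A : Set F,
    (∀ x, M.s0 x ∈ A ↔ x ∉ A) ∧ (∀ x, M.s1 x ∈ A ↔ x ∉ A) ∧ (∀ x, M.s2 x ∈ A ↔ x ∉ A)

end CMap

/-- Two maps are isomorphic if there is a bijection between their flag sets
commuting with the respective involutions. -/
def CMap.Isomorphic {F F' : Type} [Fintype F] [Fintype F'] (M : CMap F) (N : CMap F') : Prop :=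
  ∃ e : F ≃ F',
    (∀ x, e (M.s0 x) = N.s0 (e x)) ∧ (∀ x, e (M.s1 x) = N.s1 (e x)) ∧
    (∀ x, e (M.s2 x) = N.s2 (e x))

/-- The property: vertex-transitive equivelar map of Schläfli type `{3, 7}` with
Euler characteristic `-2` that is neither regular nor chiral. -/
def GoodMap {F : Type} [Fintype F] (M : CMap F) : Prop :=
  M.VertexTransitive ∧ M.Equivelar 3 7 ∧ M.euler = -2 ∧
    ¬ M.IsRegular ∧ ¬ M.IsChiral


/-! ### Orbits of subgroups generated by involutions -/

namespace Equiv.Perm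

variable {F : Type*}

lemma apply_apply_of_mul_self {a : Perm F} (h : a * a = 1) (x : F) : a (a x) = x := by
  simpa using congrArg (fun p : Perm F => p x) h

lemma inv_eq_of_mul_self {a : Perm F} (h : a * a = 1) : a⁻¹ = a :=
  inv_eq_of_mul_eq_one_left h

/-- A set preserved by involutive generators is preserved by the generated subgroup. -/
lemma closure_preserves {T : Set (Perm F)} (hT : ∀ t ∈ T, t * t = 1) {S : Set F}
    (hS : ∀ t ∈ T, ∀ y ∈ S, t y ∈ S) {g : Perm F} (hg : g ∈ Subgroup.closure T) :
    ∀ y ∈ S, g y ∈ S := by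
  induction hg using Subgroup.closure_induction'' with
  | mem x hx => exact hS x hx
  | inv_mem x hx => rw [inv_eq_of_mul_self (hT x hx)]; exact hS x hx
  | one => exact fun y hy => hy
  | mul x y _ _ ihx ihy => exact fun z hz => ihx _ (ihy z hz)

lemma orbit_closure_subset {T : Set (Perm F)} (hT : ∀ t ∈ T, t * t = 1) {S : Set F}
    (hS : ∀ t ∈ T, ∀ y ∈ S, t y ∈ S) {x : F} (hx : x ∈ S) :
    MulAction.orbit (Subgroup.closure T) x ⊆ S := by
  rintro _ ⟨⟨g, hg⟩, rfl⟩
  exact closure_preserves hT hS hg x hx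

lemma mem_orbit_closure_apply {T : Set (Perm F)} {t : Perm F} (ht : t ∈ T) {x y : F}
    (hy : y ∈ MulAction.orbit (Subgroup.closure T) x) :
    t y ∈ MulAction.orbit (Subgroup.closure T) x := by
  obtain ⟨g, rfl⟩ := hy
  exact ⟨⟨t, Subgroup.subset_closure ht⟩ * g, rfl⟩

/-- The orbit of a flag under two fixed-point-free involutions, one of which does not agree with
the other anywhere on it, is twice as long as the cycle of their product. -/
lemma card_orbit_closure_pair [Finite F] {a b : Perm F} (ha : a * a = 1) (hb : b * b = 1)
    (fa : ∀ x, a x ≠ x) (fb : ∀ x, b x ≠ x) (x : F) :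
    Nat.card (MulAction.orbit (Subgroup.closure ({a, b} : Set (Perm F))) x) =
      2 * Function.minimalPeriod (b * a) x := by
  classical
  have a2 := apply_apply_of_mul_self ha
  have b2 := apply_apply_of_mul_self hb
  set r := b * a with hr
  have hrb : ∀ y, b (r y) = a y := fun y => b2 _
  have hra : ∀ y, r (a y) = b y := fun y => by simp [hr, a2]
  have conj : ∀ (m : ℕ) y, a ((r ^ m) y) = (r⁻¹ ^ m) (a y) := by
    intro m
    induction m with
    | zero => intro y; rfl
    | succ m ih =>
      intro y
      have : ∀ z, a (r z) = r⁻¹ (a z) := fun z => by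
        rw [eq_inv_iff_eq, hra]; exact hrb z
      rw [pow_succ', mul_apply, this, ih, pow_succ' r⁻¹, mul_apply]
  have ne : ∀ (k : ℕ) y, a y ≠ (r ^ k) y := by
    intro k y h
    obtain ⟨m, hm⟩ := Nat.even_or_odd' k
    have key : a ((r ^ m) y) = (r ^ (k - m)) y := by
      rw [conj, h, ← mul_apply, inv_pow, ← zpow_natCast, ← zpow_natCast, ← zpow_natCast,
        ← zpow_neg, ← zpow_add]
      congr 2
      omega
    rcases hm with hm | hm
    · rw [show k - m = m by omega] at key
      exact fa _ key
    · rw [show k - m = m + 1 by omega, pow_succ', mul_apply] at key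
      have : b (a ((r ^ m) y)) = a ((r ^ m) y) := by
        conv_rhs => rw [key]
        rfl
      exact fb _ this
  have hper : ∀ k : ℕ, (r ^ k) x = r^[k] x := fun k => by rw [iterate_eq_pow]
  have hpos : 0 < Function.minimalPeriod r x :=
    Function.minimalPeriod_pos_of_mem_periodicPts
      (Function.mem_periodicPts.2 ⟨orderOf r, orderOf_pos r, by
        rw [Function.IsPeriodicPt, Function.IsFixedPt, iterate_eq_pow, pow_orderOf_eq_one]; rfl⟩)
  set n := Function.minimalPeriod r x with hn
  have hfull : (r ^ n) x = x := by rw [hper, hn, Function.iterate_minimalPeriod]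
  let f : Fin n ⊕ Fin n → F := Sum.elim (fun k => (r ^ (k : ℕ)) x) (fun k => a ((r ^ (k : ℕ)) x))
  have inj0 : ∀ i j : Fin n, (r ^ (i : ℕ)) x = (r ^ (j : ℕ)) x → i = j := by
    intro i j h
    rw [hper, hper] at h
    exact Fin.ext ((Function.iterate_eq_iterate_iff_of_lt_minimalPeriod i.2 j.2).1 h)
  have cross : ∀ i j : Fin n, (r ^ (i : ℕ)) x ≠ a ((r ^ (j : ℕ)) x) := by
    intro i j h
    have h2 : (r ^ (i : ℕ)) x = (r ^ ((i : ℕ) + (n - j))) ((r ^ (j : ℕ)) x) := by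
      rw [← mul_apply, ← pow_add, show (i : ℕ) + (n - j) + j = i + n by omega, pow_add, mul_apply,
        hfull]
    exact ne _ _ (h.symm.trans h2)
  have finj : Function.Injective f := by
    rintro (i | i) (j | j) h
    · rw [inj0 i j h]
    · exact absurd h (cross i j)
    · exact absurd h.symm (cross j i)
    · rw [inj0 i j (a.injective h)]
  have powmem : ∀ k : ℕ, (r ^ k) x ∈ Set.range f := fun k =>
    ⟨Sum.inl ⟨k % n, Nat.mod_lt _ hpos⟩, by
      change (r ^ (k % n)) x = _
      rw [hper, hper, hn, Function.iterate_mod_minimalPeriod_eq]⟩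
  have apowmem : ∀ k : ℕ, a ((r ^ k) x) ∈ Set.range f := fun k =>
    ⟨Sum.inr ⟨k % n, Nat.mod_lt _ hpos⟩, by
      change a ((r ^ (k % n)) x) = _
      rw [hper, hper, hn, Function.iterate_mod_minimalPeriod_eq]⟩
  have horb : MulAction.orbit (Subgroup.closure ({a, b} : Set (Perm F))) x = Set.range f := by
    apply Set.Subset.antisymm
    · apply orbit_closure_subset
      · rintro t (rfl | rfl) <;> assumption
      · rintro t (rfl | rfl) _ ⟨i | i, rfl⟩
        · exact apowmem i
        · change t (t _) ∈ _
          rw [a2]; exact powmem i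
        · change t ((r ^ (i : ℕ)) x) ∈ _
          have : (r ^ (i : ℕ)) x = r ((r ^ ((i : ℕ) + (n - 1))) x) := by
            rw [← mul_apply, ← pow_succ', show (i : ℕ) + (n - 1) + 1 = i + n by omega, pow_add,
              mul_apply, hfull]
          rw [this, hrb]; exact apowmem _
        · change r ((r ^ (i : ℕ)) x) ∈ _
          rw [← mul_apply, ← pow_succ']; exact powmem _
      · exact powmem 0
    · have pm : ∀ k : ℕ, (r ^ k) x ∈
          MulAction.orbit (Subgroup.closure ({a, b} : Set (Perm F))) x := by
        intro k
        induction k with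
        | zero => exact MulAction.mem_orbit_self x
        | succ k ih =>
          rw [pow_succ']
          exact mem_orbit_closure_apply (t := b) (by simp)
            (mem_orbit_closure_apply (t := a) (by simp) ih)
      rintro _ ⟨i | i, rfl⟩
      · exact pm i
      · exact mem_orbit_closure_apply (by simp) (pm i)
  rw [horb, Nat.card_congr (Equiv.ofInjective f finj).symm]
  simp [two_mul]

lemma pow_apply_of_card_orbit [Finite F] {a b : Perm F} (ha : a * a = 1) (hb : b * b = 1)
    (fa : ∀ x, a x ≠ x) (fb : ∀ x, b x ≠ x) {n : ℕ} {x : F}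
    (h : Nat.card (MulAction.orbit (Subgroup.closure ({a, b} : Set (Perm F))) x) = 2 * n) :
    ((b * a) ^ n) x = x := by
  rw [card_orbit_closure_pair ha hb fa fb] at h
  rw [← show Function.minimalPeriod (b * a) x = n by omega, ← iterate_eq_pow,
    Function.iterate_minimalPeriod]

end Equiv.Perm

lemma Equiv.Perm.card_orbit_closure_pair_of_prime {F : Type*} [Finite F] {a b : Equiv.Perm F}
    (ha : a * a = 1) (hb : b * b = 1) (fa : ∀ x, a x ≠ x) (fb : ∀ x, b x ≠ x) {p : ℕ}
    (hp : p.Prime) (h : (b * a) ^ p = 1) (hne : ∀ x, b (a x) ≠ x) (x : F) :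
    Nat.card (MulAction.orbit (Subgroup.closure ({a, b} : Set (Equiv.Perm F))) x) = 2 * p := by
  have : Fact p.Prime := ⟨hp⟩
  rw [card_orbit_closure_pair ha hb fa fb, Function.minimalPeriod_eq_prime (p := p)]
  · rw [Function.IsPeriodicPt, Function.IsFixedPt, iterate_eq_pow, h]; rfl
  · exact hne x

/-- Double counting for a partition into blocks of equal size. -/
lemma Nat.card_range_mul_of_card_eq {F : Type*} [Finite F] {f : F → Set F}
    (hf : ∀ x y, y ∈ f x ↔ f y = f x) {k : ℕ} (hk : ∀ x, Nat.card (f x) = k) :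
    Nat.card (Set.range f) * k = Nat.card F := by
  have e := Equiv.sigmaFiberEquiv (Set.rangeFactorization f)
  have := Fintype.ofFinite (Set.range f)
  rw [← Nat.card_congr e, Nat.card_sigma, Nat.card_eq_fintype_card, ← smul_eq_mul,
    ← Finset.card_univ, ← Finset.sum_const]
  refine Finset.sum_congr rfl fun y _ => ?_
  obtain ⟨_, x, rfl⟩ := y
  rw [← hk x]
  refine Nat.card_congr (Equiv.subtypeEquivRight fun y => ?_)
  rw [hf]
  exact ⟨fun e => Subtype.ext e, fun e => congrArg Subtype.val e⟩

namespace CMap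

variable {F : Type} [Fintype F] (M : CMap F)

lemma s0_s0 (x : F) : M.s0 (M.s0 x) = x := Equiv.Perm.apply_apply_of_mul_self M.invol0 x
lemma s1_s1 (x : F) : M.s1 (M.s1 x) = x := Equiv.Perm.apply_apply_of_mul_self M.invol1 x
lemma s2_s2 (x : F) : M.s2 (M.s2 x) = x := Equiv.Perm.apply_apply_of_mul_self M.invol2 x

lemma s0_s2 (x : F) : M.s0 (M.s2 x) = M.s2 (M.s0 x) := by
  have h : M.s0 (M.s2 (M.s0 (M.s2 x))) = x :=
    Equiv.Perm.apply_apply_of_mul_self M.invol02 x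
  have := congrArg (fun y => M.s2 (M.s0 y)) h
  simpa [s0_s0, s2_s2] using this

/-- A set of flags containing a flag and closed under the three involutions is everything. -/
lemma flag_induction {S : Set F} {x : F} (hx : x ∈ S) (h0 : ∀ y ∈ S, M.s0 y ∈ S)
    (h1 : ∀ y ∈ S, M.s1 y ∈ S) (h2 : ∀ y ∈ S, M.s2 y ∈ S) (y : F) : y ∈ S := by
  obtain ⟨g, hg, rfl⟩ := M.conn x y
  refine Equiv.Perm.closure_preserves ?_ ?_ hg x hx
  · rintro t (rfl | rfl | rfl)
    exacts [M.invol0, M.invol1, M.invol2]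
  · rintro t (rfl | rfl | rfl)
    exacts [h0, h1, h2]

lemma card_edgeOf (x : F) : Nat.card (M.edgeOf x) = 4 := by
  refine Equiv.Perm.card_orbit_closure_pair_of_prime M.invol0 M.invol2 M.fpf0 M.fpf2
    Nat.prime_two ?_ ?_ x
  · ext y
    simp [pow_two, ← s0_s2, s0_s0, s2_s2]
  · intro y h
    exact M.fpf02 y (by rw [s0_s2, h])

lemma euler_mul (h : M.Equivelar 3 7) : 84 * M.euler = -(Fintype.card F : ℤ) := by
  have key : ∀ T : Set (Equiv.Perm F), ∀ x y : F,
      y ∈ MulAction.orbit (Subgroup.closure T) x ↔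
        MulAction.orbit (Subgroup.closure T) y = MulAction.orbit (Subgroup.closure T) x :=
    fun T x y => MulAction.orbit_eq_iff.symm
  have hv : M.numVertices * 14 = Nat.card F := Nat.card_range_mul_of_card_eq (key _) h.2
  have he : M.numEdges * 4 = Nat.card F := Nat.card_range_mul_of_card_eq (key _) M.card_edgeOf
  have hf : M.numFaces * 6 = Nat.card F := Nat.card_range_mul_of_card_eq (key _) h.1
  rw [Nat.card_eq_fintype_card] at hv he hf
  rw [euler]
  omega

lemma s1_s0_pow_three (h : M.Equivelar 3 7) (x : F) :
    M.s1 (M.s0 (M.s1 (M.s0 (M.s1 (M.s0 x))))) = x := by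
  simpa [pow_succ] using
    Equiv.Perm.pow_apply_of_card_orbit M.invol0 M.invol1 M.fpf0 M.fpf1 (h.1 x)

lemma s2_s1_pow_seven (h : M.Equivelar 3 7) (x : F) : ((M.s2 * M.s1) ^ 7) x = x :=
  Equiv.Perm.pow_apply_of_card_orbit M.invol1 M.invol2 M.fpf1 M.fpf2 (h.2 x)

/-! ### Automorphisms -/

lemma mem_aut_iff {g : Equiv.Perm F} : g ∈ M.aut ↔
    (∀ x, g (M.s0 x) = M.s0 (g x)) ∧ (∀ x, g (M.s1 x) = M.s1 (g x)) ∧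
      (∀ x, g (M.s2 x) = M.s2 (g x)) := by
  simp only [aut, Subgroup.mem_centralizer_iff, Set.mem_insert_iff, Set.mem_singleton_iff,
    forall_eq_or_imp, forall_eq]
  simp only [Equiv.ext_iff, Equiv.Perm.mul_apply, eq_comm]

variable {M}

lemma aut_s0 (g : M.aut) (x : F) : g.1 (M.s0 x) = M.s0 (g.1 x) := (M.mem_aut_iff.1 g.2).1 x
lemma aut_s1 (g : M.aut) (x : F) : g.1 (M.s1 x) = M.s1 (g.1 x) := (M.mem_aut_iff.1 g.2).2.1 x
lemma aut_s2 (g : M.aut) (x : F) : g.1 (M.s2 x) = M.s2 (g.1 x) := (M.mem_aut_iff.1 g.2).2.2 x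

lemma aut_eq_of_apply_eq {g h : M.aut} {x : F} (e : g.1 x = h.1 x) : g = h := by
  refine Subtype.ext (Equiv.ext fun y => ?_)
  refine M.flag_induction (S := {y | g.1 y = h.1 y}) e ?_ ?_ ?_ y
  · intro y (hy : g.1 y = h.1 y)
    change g.1 _ = h.1 _
    rw [aut_s0, aut_s0, hy]
  · intro y (hy : g.1 y = h.1 y)
    change g.1 _ = h.1 _
    rw [aut_s1, aut_s1, hy]
  · intro y (hy : g.1 y = h.1 y)
    change g.1 _ = h.1 _
    rw [aut_s2, aut_s2, hy]

variable (M)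

/-- Two flags are equivalent if an automorphism carries one to the other. -/
def Equi (x y : F) : Prop := ∃ g : M.aut, g.1 x = y

variable {M}

lemma Equi.refl (x : F) : M.Equi x x := ⟨1, rfl⟩

lemma Equi.symm {x y : F} : M.Equi x y → M.Equi y x := by
  rintro ⟨g, rfl⟩
  exact ⟨g⁻¹, by simp⟩

lemma Equi.trans {x y z : F} : M.Equi x y → M.Equi y z → M.Equi x z := by
  rintro ⟨g, rfl⟩ ⟨h, rfl⟩
  exact ⟨h * g, rfl⟩

lemma Equi.s0 {x y : F} : M.Equi x y → M.Equi (M.s0 x) (M.s0 y) := by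
  rintro ⟨g, rfl⟩
  exact ⟨g, aut_s0 g x⟩

lemma Equi.s1 {x y : F} : M.Equi x y → M.Equi (M.s1 x) (M.s1 y) := by
  rintro ⟨g, rfl⟩
  exact ⟨g, aut_s1 g x⟩

lemma Equi.s2 {x y : F} : M.Equi x y → M.Equi (M.s2 x) (M.s2 y) := by
  rintro ⟨g, rfl⟩
  exact ⟨g, aut_s2 g x⟩

lemma mem_flagOrbit {x y : F} : y ∈ M.flagOrbit x ↔ M.Equi x y :=
  Iff.rfl

lemma flagOrbit_eq_iff {x y : F} : M.flagOrbit x = M.flagOrbit y ↔ M.Equi y x :=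
  MulAction.orbit_eq_iff

lemma isRegular_of_forall_equi {x : F} (h : ∀ y, M.Equi x y) : M.IsRegular := by
  have : Set.range M.flagOrbit = {M.flagOrbit x} := by
    ext S
    constructor
    · rintro ⟨y, rfl⟩
      exact flagOrbit_eq_iff.2 (h y)
    · rintro rfl
      exact ⟨x, rfl⟩
  rw [IsRegular, IsKOrbit, numFlagOrbits, this]
  simp

/-- If at most two flag orbits occur, they are interchanged by `s1` and `s2`, then the map is
regular or chiral. -/
lemma isRegular_or_isChiral (h3 : ∀ x, M.s1 (M.s0 (M.s1 (M.s0 (M.s1 (M.s0 x))))) = x) {x : F}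
    (h : ∀ y, M.Equi x y ∨ M.Equi (M.s1 x) y) (h12 : M.Equi (M.s1 x) (M.s2 x)) :
    M.IsRegular ∨ M.IsChiral := by
  by_cases hx : M.Equi x (M.s1 x)
  · exact Or.inl (isRegular_of_forall_equi fun y => (h y).elim id hx.trans)
  right
  have two : Set.range M.flagOrbit = {M.flagOrbit x, M.flagOrbit (M.s1 x)} := by
    ext S
    constructor
    · rintro ⟨y, rfl⟩
      exact (h y).imp flagOrbit_eq_iff.2 flagOrbit_eq_iff.2
    · rintro (rfl | rfl) <;> exact ⟨_, rfl⟩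
  have ne : M.flagOrbit x ≠ M.flagOrbit (M.s1 x) := fun e => hx (flagOrbit_eq_iff.1 e).symm
  have hx0 : ¬ M.Equi x (M.s0 x) := by
    intro e0
    have e1 : M.Equi (M.s1 x) (M.s0 (M.s1 x)) := by
      refine (h _).resolve_left fun e => hx ?_
      exact e0.trans (by simpa [s0_s0] using e.s0)
    have a1 := e0.s1
    have a2 := e1.trans a1.s0
    have a3 : M.Equi x (M.s1 (M.s0 (M.s1 (M.s0 x)))) := by simpa [s1_s1] using a2.s1
    have a4 := e0.trans a3.s0
    have a5 := a4.s1
    rw [h3] at a5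
    exact hx a5.symm
  have hx2 : ¬ M.Equi x (M.s2 x) := fun e => hx (e.trans h12.symm)
  have up : ∀ s : Equiv.Perm F, (∀ y, s (s y) = y) → (∀ y z, M.Equi y z → M.Equi (s y) (s z)) →
      ¬ M.Equi x (s x) → ∀ y, s y ∉ M.flagOrbit y := by
    intro s ss hs hsx y hy
    rw [mem_flagOrbit] at hy
    rcases h y with e | e
    · exact hsx (e.trans (hy.trans (hs _ _ e).symm))
    · have e' := (h (s x)).resolve_left hsx
      have q := hs _ _ (e'.symm.trans e)
      rw [ss] at q
      exact hx (q.trans (hy.symm.trans e.symm))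
  refine ⟨?_, fun y => ⟨up _ M.s0_s0 (fun _ _ => Equi.s0) hx0 y,
    up _ M.s1_s1 (fun _ _ => Equi.s1) hx y, up _ M.s2_s2 (fun _ _ => Equi.s2) hx2 y⟩⟩
  rw [IsKOrbit, numFlagOrbits, two, Nat.card_coe_set_eq, Set.ncard_pair ne]

end CMap

/-! ### The action on the fourteen flags at a vertex -/

/-- The first involution on the flags around a vertex of degree seven, in cyclic order. -/
def rowA (i : Fin 14) : Fin 14 := if i.val % 2 = 0 then i + 1 else i - 1

/-- The second involution on the flags around a vertex of degree seven, in cyclic order. -/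
def rowB (i : Fin 14) : Fin 14 := if i.val % 2 = 0 then i - 1 else i + 1

/-- The symmetry of the flags around a vertex that sends `0` to `k`. -/
def rot (k i : Fin 14) : Fin 14 := if k.val % 2 = 0 then k + i else k - i

lemma rowA_rot : ∀ k i, rot k (rowA i) = rowA (rot k i) := by decide +kernel

lemma rowB_rot : ∀ k i, rot k (rowB i) = rowB (rot k i) := by decide +kernel

lemma rot_zero : ∀ k, rot k 0 = k := by decide

/-- One of the two quotient structures on the flags at a vertex not respecting parity. -/
def typeP : Fin 14 → Fin 14 := ![1, 0, 13, 4, 3, 12, 11, 9, 10, 7, 8, 6, 5, 2]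

/-- The other quotient structure on the flags at a vertex not respecting parity. -/
def typeQ : Fin 14 → Fin 14 := ![1, 0, 13, 7, 8, 11, 12, 3, 4, 10, 9, 5, 6, 2]

/-- The property that `p` reverses parity, or is one of two actions up to `rot`. -/
def IsKnownType (p : Fin 14 → Fin 14) : Prop :=
  (∀ i, (p i).val % 2 ≠ i.val % 2) ∨ ∃ k, (∀ i, p (rot k i) = rot k (typeP i)) ∨
    ∀ i, p (rot k i) = rot k (typeQ i)

instance : DecidablePred IsKnownType := fun _ => inferInstanceAs (Decidable (_ ∨ _))

/-- The involution determined by its values at `12`, `5`, `7`, `9`, given that it sends `0`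
to `1`. -/
def typeTable (u a b c : Fin 14) : Fin 14 → Fin 14 :=
  ![1, 0, 13, rowA u, rowB (rowA u), a, rowB a, b, rowB b, c, rowB c, rowB u, u, 2]

lemma isKnownType_typeTable : ∀ u, u ∉ [1, 0, 13, 2] →
    ∀ a, a ∉ [1, 0, 13, 2, u, rowB u, rowA u, rowB (rowA u)] →
    ∀ b, b ∉ [1, 0, 13, 2, u, rowB u, rowA u, rowB (rowA u), a, rowB a] →
    ∀ c, c ∉ [1, 0, 13, 2, u, rowB u, rowA u, rowB (rowA u), a, rowB a, b, rowB b] →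
    (∀ i, typeTable u a b c (typeTable u a b c i) = i) →
    (∀ i, rowA (typeTable u a b c (rowA (typeTable u a b c (rowA (typeTable u a b c i))))) = i) →
    IsKnownType (typeTable u a b c) := by decide +kernel

/-- Classification of the actions on the flags at a vertex of a vertex-regular quotient, for a
suitably chosen base flag. -/
lemma isKnownType_of_apply_zero {p : Fin 14 → Fin 14} (hinv : ∀ i, p (p i) = i)
    (hB : ∀ i, p (rowB i) = rowB (p i)) (hA : ∀ i, rowA (p (rowA (p (rowA (p i))))) = i)
    (h0 : p 0 = 1) : IsKnownType p := by
  have inj : Function.Injective p := Function.LeftInverse.injective (g := p) hinv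
  have h1 : p 1 = 0 := by rw [← h0, hinv]
  have h13 : p 13 = 2 := by
    have := hB 0
    rwa [h0] at this
  have h2 : p 2 = 13 := by rw [← h13, hinv]
  have h11 : p 11 = rowB (p 12) := hB 12
  have h3 : p 3 = rowA (p 12) := by
    have := hA 2
    rw [h2] at this
    replace this : rowA (p (rowA (p 12))) = 2 := this
    have iA : ∀ i, rowA (rowA i) = i := by decide
    have e : p (rowA (p 12)) = 3 := by rw [← iA (p _), this]; rfl
    rw [← e, hinv]
  have h4 : p 4 = rowB (rowA (p 12)) := by rw [← h3]; exact hB 3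
  have h6 : p 6 = rowB (p 5) := hB 5
  have h8 : p 8 = rowB (p 7) := hB 7
  have h10 : p 10 = rowB (p 9) := hB 9
  have ht : p = typeTable (p 12) (p 5) (p 7) (p 9) := by
    funext i
    fin_cases i <;> simp [typeTable, *]
  have nm : ∀ (i : Fin 14) (l : List (Fin 14)), i ∉ l → p i ∉ l.map p := fun i l h => by
    rwa [List.mem_map_of_injective inj]
  have key := isKnownType_typeTable (p 12)
    (by simpa only [List.map_cons, List.map_nil, h0, h1, h2, h13] using
      nm 12 [0, 1, 2, 13] (by decide)) (p 5)
    (by simpa only [List.map_cons, List.map_nil, h0, h1, h2, h13, h11, h3, h4] using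
      nm 5 [0, 1, 2, 13, 12, 11, 3, 4] (by decide)) (p 7)
    (by simpa only [List.map_cons, List.map_nil, h0, h1, h2, h13, h11, h3, h4, h6] using
      nm 7 [0, 1, 2, 13, 12, 11, 3, 4, 5, 6] (by decide)) (p 9)
    (by simpa only [List.map_cons, List.map_nil, h0, h1, h2, h13, h11, h3, h4, h6, h8] using
      nm 9 [0, 1, 2, 13, 12, 11, 3, 4, 5, 6, 7, 8] (by decide))
  rw [← ht] at key
  exact key hinv hA

lemma exists_apply_eq_rowA {p : Fin 14 → Fin 14} (hinv : ∀ i, p (p i) = i)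
    (hA : ∀ i, rowA (p (rowA (p (rowA (p i))))) = i) : ∃ k, p k = rowA k := by
  have iA : ∀ i, rowA (rowA i) = i := by decide
  let g : Equiv.Perm (Fin 14) :=
    (Function.Involutive.toPerm rowA iA) * (Function.Involutive.toPerm p hinv)
  have : Fact (Nat.Prime 3) := ⟨Nat.prime_three⟩
  obtain ⟨k, hk⟩ := Equiv.Perm.exists_fixed_point_of_prime (p := 3) (n := 1) (σ := g)
    (by simp) (by ext i; exact congrArg Fin.val (hA i))
  have hk : rowA (p k) = k := hk
  exact ⟨k, by rw [← iA (p k), hk]⟩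

namespace CMap

variable {F : Type} [Fintype F] {M : CMap F}

variable (M) in
/-- A labelling, by `Fin 14` in cyclic order, of the flags around a vertex. -/
structure IsChart (f : Fin 14 → F) : Prop where
  apply_rowA : ∀ i, f (rowA i) = M.s1 (f i)
  apply_rowB : ∀ i, f (rowB i) = M.s2 (f i)

lemma exists_isChart (h : M.Equivelar 3 7) (b : F) : ∃ f, M.IsChart f ∧ f 0 = b := by
  have h7 : ∀ x, M.s2 (M.s1 (M.s2 (M.s1 (M.s2 (M.s1 (M.s2 (M.s1 (M.s2 (M.s1 (M.s2 (M.s1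
      (M.s2 (M.s1 x))))))))))))) = x := fun x => by
    simpa [pow_succ] using M.s2_s1_pow_seven h x
  have h7' := congrArg M.s2 (h7 b)
  rw [s2_s2] at h7'
  refine ⟨![b, M.s1 b, M.s2 (M.s1 b), M.s1 (M.s2 (M.s1 b)), M.s2 (M.s1 (M.s2 (M.s1 b))),
    M.s1 (M.s2 (M.s1 (M.s2 (M.s1 b)))), M.s2 (M.s1 (M.s2 (M.s1 (M.s2 (M.s1 b))))),
    M.s1 (M.s2 (M.s1 (M.s2 (M.s1 (M.s2 (M.s1 b)))))),
    M.s2 (M.s1 (M.s2 (M.s1 (M.s2 (M.s1 (M.s2 (M.s1 b))))))),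
    M.s1 (M.s2 (M.s1 (M.s2 (M.s1 (M.s2 (M.s1 (M.s2 (M.s1 b)))))))),
    M.s2 (M.s1 (M.s2 (M.s1 (M.s2 (M.s1 (M.s2 (M.s1 (M.s2 (M.s1 b))))))))),
    M.s1 (M.s2 (M.s1 (M.s2 (M.s1 (M.s2 (M.s1 (M.s2 (M.s1 (M.s2 (M.s1 b)))))))))),
    M.s2 (M.s1 (M.s2 (M.s1 (M.s2 (M.s1 (M.s2 (M.s1 (M.s2 (M.s1 (M.s2 (M.s1 b))))))))))),
    M.s1 (M.s2 (M.s1 (M.s2 (M.s1 (M.s2 (M.s1 (M.s2 (M.s1 (M.s2 (M.s1 (M.s2 (M.s1 b))))))))))))],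
    ⟨?_, ?_⟩, rfl⟩
  · intro i
    fin_cases i
    all_goals first | rfl | exact (M.s1_s1 _).symm
  · intro i
    fin_cases i
    all_goals first | rfl | exact (M.s2_s2 _).symm | exact h7' | exact (h7 b).symm

namespace IsChart

variable {f : Fin 14 → F} (hf : M.IsChart f)
include hf

lemma comp_rot (k : Fin 14) : M.IsChart (f ∘ rot k) :=
  ⟨fun i => by simp [rowA_rot, hf.apply_rowA], fun i => by simp [rowB_rot, hf.apply_rowB]⟩

lemma exists_equi (hv : M.VertexTransitive) (y : F) : ∃ i, M.Equi (f i) y := by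
  obtain ⟨g, hg, e⟩ := hv (f 0) y
  have hy : y ∈ M.vertexOf (g (f 0)) := by
    rw [e]
    exact MulAction.mem_orbit_self y
  have := Equiv.Perm.orbit_closure_subset (S := {z | ∃ i, g (f i) = z}) ?_ ?_ ⟨0, rfl⟩ hy
  · obtain ⟨i, hi⟩ := this
    exact ⟨i, ⟨g, hg⟩, hi⟩
  · rintro t (rfl | rfl)
    exacts [M.invol1, M.invol2]
  · rintro t (rfl | rfl) _ ⟨i, rfl⟩
    · exact ⟨rowA i, by rw [hf.apply_rowA]; exact aut_s1 ⟨g, hg⟩ _⟩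
    · exact ⟨rowB i, by rw [hf.apply_rowB]; exact aut_s2 ⟨g, hg⟩ _⟩

lemma equi_rowA {i j : Fin 14} (h : M.Equi (f i) (f j)) : M.Equi (f (rowA i)) (f (rowA j)) := by
  rw [hf.apply_rowA, hf.apply_rowA]
  exact h.s1

lemma equi_rowB {i j : Fin 14} (h : M.Equi (f i) (f j)) : M.Equi (f (rowB i)) (f (rowB j)) := by
  rw [hf.apply_rowB, hf.apply_rowB]
  exact h.s2

lemma equi_rotate {i j : Fin 14} (h : M.Equi (f i) (f j)) (m : ℕ) :
    M.Equi (f ((rowB ∘ rowA)^[m] i)) (f ((rowB ∘ rowA)^[m] j)) := by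
  induction m with
  | zero => exact h
  | succ m ih =>
    rw [Function.iterate_succ_apply', Function.iterate_succ_apply']
    exact hf.equi_rowB (hf.equi_rowA ih)

lemma equi_iterate {m : ℕ} (h : M.Equi (f 0) (f ((rowB ∘ rowA)^[m] 0))) (k : ℕ) :
    M.Equi (f 0) (f ((rowB ∘ rowA)^[m * k] 0)) := by
  induction k with
  | zero => exact Equi.refl _
  | succ k ih =>
    refine h.trans ?_
    have := hf.equi_rotate ih m
    rwa [← Function.iterate_add_apply, show m + m * k = m * (k + 1) by ring] at this

/-- A nontrivial automorphism acting as a rotation about a vertex makes the map regular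
or chiral. -/
lemma isRegular_or_isChiral (he : M.Equivelar 3 7) (hv : M.VertexTransitive) {j : Fin 14}
    (hj : j ≠ 0) (hj2 : j.val % 2 = 0) (h : M.Equi (f 0) (f j)) : M.IsRegular ∨ M.IsChiral := by
  have h2 : M.Equi (f 0) (f 2) := by
    have key : ∀ j : Fin 14, j ≠ 0 → j.val % 2 = 0 → (rowB ∘ rowA)^[j.val / 2] 0 = j ∧
        ∃ k : Fin 7, (rowB ∘ rowA)^[j.val / 2 * k.val] 0 = 2 := by decide +kernel
    obtain ⟨e, k, ek⟩ := key j hj hj2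
    rw [← e] at h
    simpa only [ek] using hf.equi_iterate h k
  have h0 : ∀ m : ℕ, M.Equi (f 0) (f ((rowB ∘ rowA)^[m] 0)) := fun m => by
    simpa only [one_mul] using hf.equi_iterate (m := 1) h2 m
  have h1 : ∀ i, M.Equi (f 0) (f i) ∨ M.Equi (f 1) (f i) := by
    intro i
    have key : ∀ i : Fin 14, ∃ m : Fin 7,
        (rowB ∘ rowA)^[m.val] 0 = i ∨ rowA ((rowB ∘ rowA)^[m.val] 0) = i := by decide +kernel
    obtain ⟨m, rfl | rfl⟩ := key i
    · exact Or.inl (h0 m)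
    · exact Or.inr (hf.equi_rowA (h0 m))
  refine CMap.isRegular_or_isChiral (M.s1_s0_pow_three he) (x := f 0) (fun y => ?_) ?_
  · obtain ⟨i, hi⟩ := hf.exists_equi hv y
    rw [← hf.apply_rowA]
    exact (h1 i).imp (·.trans hi) (·.trans hi)
  · rw [← hf.apply_rowA, ← hf.apply_rowB]
    exact hf.equi_rowA (h0 6)

end IsChart

/-- The involution `s0` acts on the automorphism orbits of flags. -/
lemma exists_type_action (he : M.Equivelar 3 7) {n : ℕ} {f : Fin n → F} {a b : Fin n → Fin n}
    (ha : ∀ i, M.Equi (f (a i)) (M.s1 (f i))) (hb : ∀ i, M.Equi (f (b i)) (M.s2 (f i)))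
    (inj : ∀ i j, M.Equi (f i) (f j) → i = j) (cover : ∀ y, ∃ i, M.Equi (f i) y) :
    ∃ p : Fin n → Fin n, (∀ i, M.Equi (f (p i)) (M.s0 (f i))) ∧ (∀ i, p (p i) = i) ∧
      (∀ i, p (b i) = b (p i)) ∧ ∀ i, a (p (a (p (a (p i))))) = i := by
  choose p hp using fun i => cover (M.s0 (f i))
  refine ⟨p, hp, fun i => inj _ _ ?_, fun i => inj _ _ ?_, fun i => inj _ _ ?_⟩
  · refine (hp _).trans ?_
    simpa only [s0_s0] using (hp i).s0
  · have h1 := (hp (b i)).trans (hb i).s0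
    rw [s0_s2] at h1
    exact h1.trans ((hb (p i)).trans (hp i).s2).symm
  · have step : ∀ i y, M.Equi (f i) y → M.Equi (f (a (p i))) (M.s1 (M.s0 y)) := fun i y h =>
      (ha (p i)).trans ((hp i).trans h.s0).s1
    have := step _ _ (step _ _ (step _ _ (Equi.refl (f i))))
    rwa [M.s1_s0_pow_three he] at this

/-- No vertex-transitive map of type `{3, 7}` is a `7`-orbit map. -/
lemma no_seven_orbit_action (p : Fin 7 → Fin 7) (hinv : ∀ i, p (p i) = i)
    (hb : ∀ i, p (![0, 2, 1, 4, 3, 6, 5] i) = ![0, 2, 1, 4, 3, 6, 5] (p i))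
    (ha : ∀ i, ![1, 0, 3, 2, 5, 4, 6] (p (![1, 0, 3, 2, 5, 4, 6]
      (p (![1, 0, 3, 2, 5, 4, 6] (p i))))) = i) : False := by
  have key : ∀ x y z : Fin 7, ∀ q : Fin 7 → Fin 7,
      q = ![0, x, ![0, 2, 1, 4, 3, 6, 5] x, y, ![0, 2, 1, 4, 3, 6, 5] y, z,
        ![0, 2, 1, 4, 3, 6, 5] z] → (∀ i, q (q i) = i) →
      ¬ ∀ i, ![1, 0, 3, 2, 5, 4, 6] (q (![1, 0, 3, 2, 5, 4, 6]
        (q (![1, 0, 3, 2, 5, 4, 6] (q i))))) = i := by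
    simp only [forall_eq]
    decide +kernel
  refine key (p 1) (p 3) (p 5) p ?_ hinv ha
  have h0 : p 0 = 0 := by
    have h := hb 0
    have : ∀ c : Fin 7, c = ![0, 2, 1, 4, 3, 6, 5] c → c = 0 := by decide
    exact this _ h
  have h2 := hb 1
  have h4 := hb 3
  have h6 := hb 5
  funext i
  fin_cases i
  exacts [h0, rfl, h2, rfl, h4, rfl, h6]

namespace IsChart

variable {f : Fin 14 → F}

/-- In a vertex-transitive map of type `{3, 7}` that is neither regular nor chiral, vertex
stabilizers are trivial. -/
lemma eq_of_equi (hf : M.IsChart f) (he : M.Equivelar 3 7) (hv : M.VertexTransitive)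
    (hr : ¬ M.IsRegular) (hc : ¬ M.IsChiral) {i j : Fin 14} (h : M.Equi (f i) (f j)) : i = j := by
  have par : ∀ {f : Fin 14 → F}, M.IsChart f → ∀ {i j : Fin 14}, i.val % 2 = j.val % 2 →
      M.Equi (f i) (f j) → i = j := by
    intro f hf i j hij h
    by_contra hne
    have key : ∀ i j : Fin 14, i.val % 2 = j.val % 2 → i ≠ j →
        ∃ k, rot i k = j ∧ k ≠ 0 ∧ k.val % 2 = 0 := by decide +kernel
    obtain ⟨k, rfl, hk, hk2⟩ := key i j hij hne
    rcases (hf.comp_rot i).isRegular_or_isChiral he hv hk hk2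
      (by simpa [rot_zero] using h) with h | h
    exacts [hr h, hc h]
  by_contra hne
  have hij : i.val % 2 ≠ j.val % 2 := fun e => hne (par hf e h)
  obtain ⟨k, hk⟩ : ∃ k, M.Equi (f k) (f (rowB k)) := by
    have key : ∀ i j : Fin 14, i.val % 2 ≠ j.val % 2 → ∃ m : Fin 7,
        (rowB ∘ rowA)^[m.val] j = rowB ((rowB ∘ rowA)^[m.val] i) := by decide +kernel
    obtain ⟨m, hm⟩ := key i j hij
    exact ⟨_, hm ▸ hf.equi_rotate h m⟩
  have hg := hf.comp_rot k
  set g := f ∘ rot k with hgdef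
  have g0 : M.Equi (g 0) (g 13) := by
    rw [hg.apply_rowB 0 |> (show g 13 = M.s2 (g 0) from ·)]
    simpa [hgdef, rot_zero, ← hf.apply_rowB] using hk
  have flip : ∀ i, M.Equi (g i) (g (13 - i)) := by
    intro i
    have key : ∀ i : Fin 14, ∃ m : Fin 7, ((rowB ∘ rowA)^[m.val] 0 = i ∧
        (rowB ∘ rowA)^[m.val] 13 = 13 - i) ∨ ((rowB ∘ rowA)^[m.val] 13 = i ∧
        (rowB ∘ rowA)^[m.val] 0 = 13 - i) := by decide +kernel
    obtain ⟨m, ⟨e1, e2⟩ | ⟨e1, e2⟩⟩ := key i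
    · have := hg.equi_rotate g0 m
      rwa [e1, e2] at this
    · have := hg.equi_rotate g0.symm m
      rwa [e1, e2] at this
  have char : ∀ i j, M.Equi (g i) (g j) → j = i ∨ j = 13 - i := by
    intro i j h
    by_cases hp : i.val % 2 = j.val % 2
    · exact Or.inl (par hg hp h).symm
    · right
      have key : ∀ i j : Fin 14, i.val % 2 ≠ j.val % 2 → (13 - i).val % 2 = j.val % 2 := by
        decide
      exact (par hg (key i j hp) ((flip i).symm.trans h)).symm
  let e : Fin 7 → Fin 14 := Fin.castLE (by norm_num)
  have hA : ∀ i, M.Equi (g (e (![1, 0, 3, 2, 5, 4, 6] i))) (M.s1 (g (e i))) := by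
    intro i
    have key : ∀ i, e (![1, 0, 3, 2, 5, 4, 6] i) = rowA (e i) ∨
        e (![1, 0, 3, 2, 5, 4, 6] i) = 13 - rowA (e i) := by decide
    rw [← hg.apply_rowA]
    rcases key i with h | h <;> rw [h]
    exacts [Equi.refl _, (flip _).symm]
  have hB : ∀ i, M.Equi (g (e (![0, 2, 1, 4, 3, 6, 5] i))) (M.s2 (g (e i))) := by
    intro i
    have key : ∀ i, e (![0, 2, 1, 4, 3, 6, 5] i) = rowB (e i) ∨
        e (![0, 2, 1, 4, 3, 6, 5] i) = 13 - rowB (e i) := by decide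
    rw [← hg.apply_rowB]
    rcases key i with h | h <;> rw [h]
    exacts [Equi.refl _, (flip _).symm]
  have inj : ∀ i j, M.Equi (g (e i)) (g (e j)) → i = j := by
    intro i j h
    have key : ∀ i j, e j = e i ∨ e j = 13 - e i → i = j := by decide
    exact key i j (char _ _ h)
  have cover : ∀ y, ∃ i, M.Equi (g (e i)) y := by
    intro y
    obtain ⟨i, hi⟩ := hg.exists_equi hv y
    have key : ∀ i : Fin 14, ∃ j, e j = i ∨ e j = 13 - i := by decide
    obtain ⟨j, h | h⟩ := key i
    · exact ⟨j, by rw [h]; exact hi⟩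
    · exact ⟨j, by rw [h]; exact (flip i).symm.trans hi⟩
  obtain ⟨p, -, h1, h2, h3⟩ := exists_type_action he (f := g ∘ e) hA hB inj cover
  exact no_seven_orbit_action p h1 h2 h3

/-- In a suitable chart, the action of `s0` on automorphism orbits either reverses parity or is
one of two explicit actions. -/
lemma exists_type (he : M.Equivelar 3 7) (hv : M.VertexTransitive)
    (hr : ¬ M.IsRegular) (hc : ¬ M.IsChiral) :
    ∃ (f : Fin 14 → F) (p : Fin 14 → Fin 14), M.IsChart f ∧
      (∀ i, M.Equi (f (p i)) (M.s0 (f i))) ∧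
      ((∀ i, (p i).val % 2 ≠ i.val % 2) ∨ p = typeP ∨ p = typeQ) := by
  obtain ⟨f, hf, -⟩ := exists_isChart he M.nonempty.some
  have act : ∀ {f}, M.IsChart f → _ := fun {f} hf =>
    exists_type_action he (f := f) (a := rowA) (b := rowB)
      (fun i => hf.apply_rowA i ▸ Equi.refl _) (fun i => hf.apply_rowB i ▸ Equi.refl _)
      (fun i j h => hf.eq_of_equi he hv hr hc h) (hf.exists_equi hv)
  obtain ⟨p, hp, h1, h2, h3⟩ := act hf
  obtain ⟨k, hk⟩ := exists_apply_eq_rowA h1 h3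
  have hf' := hf.comp_rot k
  obtain ⟨q, hq, q1, q2, q3⟩ := act hf'
  have q0 : q 0 = 1 := by
    refine hf'.eq_of_equi he hv hr hc ((hq 0).trans ?_)
    have := (hp k).symm
    rw [hk, hf.apply_rowA] at this
    rw [show (1 : Fin 14) = rowA 0 from rfl, hf'.apply_rowA]
    simpa [rot_zero] using this
  rcases isKnownType_of_apply_zero q1 q2 q3 q0 with h | ⟨k, h⟩
  · exact ⟨_, q, hf', hq, Or.inl h⟩
  · rcases h with h | h
    · exact ⟨_, typeP, hf'.comp_rot k, fun i => by
        simpa only [Function.comp, h] using hq (rot k i), Or.inr (Or.inl rfl)⟩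
    · exact ⟨_, typeQ, hf'.comp_rot k, fun i => by
        simpa only [Function.comp, h] using hq (rot k i), Or.inr (Or.inr rfl)⟩

end IsChart

end CMap

namespace CMap

variable {F : Type} [Fintype F]

/-- Coordinates on the flags of `M` presenting it as a regular cover, with deck group `G`, of the
action `p` of `s0` on the flags at one vertex, with voltages `α`. -/
structure IsDerived {G : Type} [Group G] (M : CMap F) (p : Fin 14 → Fin 14) (α : Fin 14 → G)
    (e : G × Fin 14 ≃ F) : Prop where
  s0_apply : ∀ g i, M.s0 (e (g, i)) = e (g * α i, p i)
  s1_apply : ∀ g i, M.s1 (e (g, i)) = e (g, rowA i)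
  s2_apply : ∀ g i, M.s2 (e (g, i)) = e (g, rowB i)

variable {M : CMap F}

lemma IsChart.exists_isDerived {f : Fin 14 → F} {p : Fin 14 → Fin 14} (hf : M.IsChart f)
    (hv : M.VertexTransitive) (inj : ∀ i j, M.Equi (f i) (f j) → i = j)
    (hp : ∀ i, M.Equi (f (p i)) (M.s0 (f i))) :
    ∃ (α : Fin 14 → M.aut) (e : M.aut × Fin 14 ≃ F), M.IsDerived p α e := by
  choose α hα using hp
  refine ⟨α, Equiv.ofBijective (fun q => q.1.1 (f q.2)) ⟨?_, ?_⟩, ⟨?_, ?_, ?_⟩⟩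
  · rintro ⟨g, i⟩ ⟨h, j⟩ (hgh : g.1 (f i) = h.1 (f j))
    have hg : M.Equi (f i) (g.1 (f i)) := ⟨g, rfl⟩
    have hh : M.Equi (f j) (h.1 (f j)) := ⟨h, rfl⟩
    obtain rfl : i = j := inj i j (hg.trans (hgh ▸ hh.symm))
    rw [aut_eq_of_apply_eq hgh]
  · intro y
    obtain ⟨i, g, hg⟩ := hf.exists_equi hv y
    exact ⟨(g, i), hg⟩
  · intro g i
    change M.s0 (g.1 (f i)) = g.1 ((α i).1 (f (p i)))
    rw [← aut_s0, hα]
  · intro g i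
    change M.s1 (g.1 (f i)) = g.1 (f (rowA i))
    rw [← aut_s1, hf.apply_rowA]
  · intro g i
    change M.s2 (g.1 (f i)) = g.1 (f (rowB i))
    rw [← aut_s2, hf.apply_rowB]

namespace IsDerived

variable {G : Type} [Group G] {p : Fin 14 → Fin 14} {α : Fin 14 → G} {e : G × Fin 14 ≃ F}
  (h : M.IsDerived p α e)
include h

lemma mul_eq_one (i : Fin 14) : α i * α (p i) = 1 := by
  have := M.s0_s0 (e (1, i))
  rw [h.s0_apply, h.s0_apply, e.apply_eq_iff_eq, Prod.mk.injEq] at this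
  simpa using this.1

lemma apply_rowB (i : Fin 14) : α (rowB i) = α i := by
  have := M.s0_s2 (e (1, i))
  rw [h.s0_apply, h.s2_apply, h.s2_apply, h.s0_apply, e.apply_eq_iff_eq, Prod.mk.injEq] at this
  simpa using this.1

lemma mul_mul_eq_one (he : M.Equivelar 3 7) (i : Fin 14) :
    α i * α (rowA (p i)) * α (rowA (p (rowA (p i)))) = 1 := by
  have := M.s1_s0_pow_three he (e (1, i))
  simp only [h.s0_apply, h.s1_apply, e.apply_eq_iff_eq, Prod.mk.injEq] at this
  simpa using this.1

lemma closure_eq_top {x c : G} (hα : ∀ i, α i ∈ Subgroup.closure {x, c}) :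
    Subgroup.closure {x, c} = ⊤ := by
  rw [eq_top_iff]
  intro g _
  have := M.flag_induction (S := {y | (e.symm y).1 ∈ Subgroup.closure {x, c}})
    (x := e (1, 0)) (by simp [one_mem]) ?_ ?_ ?_ (e (g, 0))
  · simpa using this
  all_goals
    intro y
    obtain ⟨⟨g, i⟩, rfl⟩ := e.surjective y
    simp only [h.s0_apply, h.s1_apply, h.s2_apply, Set.mem_ofPred_eq, Equiv.symm_apply_apply]
  · exact fun hg => mul_mem hg (hα i)
  · exact id
  · exact id

lemma orientable {H : Subgroup G} (hH : ∀ a b, a * b ∈ H ↔ (a ∈ H ↔ b ∈ H))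
    (hα : ∀ i, α i ∈ H ↔ (p i).val % 2 ≠ i.val % 2) : M.Orientable := by
  refine ⟨{y | (e.symm y).1 ∈ H ↔ (e.symm y).2.val % 2 = 0}, ?_, ?_, ?_⟩
  all_goals
    intro y
    obtain ⟨⟨g, i⟩, rfl⟩ := e.surjective y
    simp only [h.s0_apply, h.s1_apply, h.s2_apply, Set.mem_ofPred_eq, Equiv.symm_apply_apply]
  · rw [hH, hα]
    by_cases hg : g ∈ H <;> simp only [hg, true_iff, false_iff] <;> omega
  · have : ∀ i : Fin 14, (rowA i).val % 2 = 0 ↔ ¬ i.val % 2 = 0 := by decide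
    by_cases hg : g ∈ H <;> simp only [hg, true_iff, false_iff, this]
  · have : ∀ i : Fin 14, (rowB i).val % 2 = 0 ↔ ¬ i.val % 2 = 0 := by decide
    by_cases hg : g ∈ H <;> simp only [hg, true_iff, false_iff, this]

lemma isomorphic {F' : Type} [Fintype F'] {M' : CMap F'} {G' : Type} [Group G']
    {α' : Fin 14 → G'} {e' : G' × Fin 14 ≃ F'} (h' : M'.IsDerived p α' e') (θ : G ≃* G')
    (hθ : ∀ i, θ (α i) = α' i) : M.Isomorphic M' := by
  refine ⟨e.symm.trans ((θ.toEquiv.prodCongr (Equiv.refl _)).trans e'), ?_, ?_, ?_⟩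
  all_goals
    intro y
    obtain ⟨⟨g, i⟩, rfl⟩ := e.surjective y
    simp [h.s0_apply, h.s1_apply, h.s2_apply, h'.s0_apply, h'.s1_apply, h'.s2_apply, hθ]

end IsDerived

end CMap

/-- The product of two disjoint transpositions of four points. -/
def doubleSwap : Equiv.Perm (Fin 4) := Equiv.swap 0 1 * Equiv.swap 2 3

/-- A cyclic permutation of three points out of four. -/
def threeCycle : Equiv.Perm (Fin 4) := Equiv.swap 0 1 * Equiv.swap 1 2

set_option synthInstance.maxSize 512 in
/-- All pairs consisting of a double transposition and a `3`-cycle are conjugate. -/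
lemma exists_conj_eq : ∀ σ τ : Equiv.Perm (Fin 4), σ * σ = 1 → σ ≠ 1 →
    (σ * (τ * τ)) * (σ * (τ * τ)) * (σ * (τ * τ)) = 1 → σ * (τ * τ) ≠ 1 →
    ∃ ρ, ρ * σ * ρ⁻¹ = doubleSwap ∧ ρ * τ * ρ⁻¹ = threeCycle := by
  decide +kernel

section

variable {G : Type} [Group G] {x c : G}

/-- If `⟨x * c ^ 2⟩` is normal then there is a subgroup of index two containing `x` but
not `c`. -/
lemma exists_index_two_of_normal (hG : Nat.card G = 12) (hgen : Subgroup.closure {x, c} = ⊤)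
    (hx : x * x = 1) (ht : (x * (c * c)) ^ 3 = 1) (hN : (Subgroup.zpowers (x * (c * c))).Normal) :
    ∃ H : Subgroup G, H.index = 2 ∧ x ∈ H ∧ c ∉ H := by
  set N := Subgroup.zpowers (x * (c * c)) with hNdef
  let π : G →* G ⧸ N := QuotientGroup.mk' N
  have hπ : Function.Surjective π := QuotientGroup.mk'_surjective N
  have h1 : π x * (π c * π c) = 1 := by
    rw [← map_mul, ← map_mul]
    exact (QuotientGroup.eq_one_iff _).2 (Subgroup.mem_zpowers _)
  have hx' : π x = (π c ^ 2)⁻¹ := by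
    rw [pow_two]
    exact eq_inv_of_mul_eq_one_left h1
  have h4 : π c ^ 4 = 1 := by
    have : π x * π x = 1 := by rw [← map_mul, hx, map_one]
    rw [hx', ← mul_inv_rev, inv_eq_one, ← pow_add] at this
    exact this
  have htop : Subgroup.zpowers (π c) = ⊤ := by
    rw [eq_top_iff, ← MonoidHom.range_eq_top.2 hπ, MonoidHom.range_eq_map, ← hgen,
      MonoidHom.map_closure, Subgroup.closure_le]
    rintro _ ⟨y, rfl | rfl, rfl⟩
    · rw [hx']
      exact inv_mem (pow_mem (Subgroup.mem_zpowers _) 2)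
    · exact Subgroup.mem_zpowers _
  have hQ : Nat.card (G ⧸ N) = orderOf (π c) := by
    rw [← Nat.card_zpowers, htop, Subgroup.card_top]
  have hcard : orderOf (π c) * orderOf (x * (c * c)) = 12 := by
    rw [← hQ, ← hG, Subgroup.card_eq_card_quotient_mul_card_subgroup N, hNdef, Nat.card_zpowers]
  have h3 : orderOf (x * (c * c)) ≤ 3 := Nat.le_of_dvd (by norm_num) (orderOf_dvd_of_pow_eq_one ht)
  have h4' : orderOf (π c) = 4 := by
    have := Nat.le_of_dvd (by norm_num) (orderOf_dvd_of_pow_eq_one h4)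
    nlinarith
  have h2 : orderOf (π c ^ 2) = 2 := by
    rw [orderOf_pow_of_dvd two_ne_zero (by rw [h4']; norm_num), h4']
  refine ⟨(Subgroup.zpowers (π c ^ 2)).comap π, ?_, ?_, ?_⟩
  · rw [Subgroup.index_comap_of_surjective _ hπ]
    have := Subgroup.card_mul_index (Subgroup.zpowers (π c ^ 2))
    rw [Nat.card_zpowers, h2, hQ, h4'] at this
    omega
  · rw [Subgroup.mem_comap, hx']
    exact inv_mem (Subgroup.mem_zpowers _)
  · intro hc
    have := orderOf_dvd_of_mem_zpowers hc
    rw [h2, h4'] at this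
    norm_num at this

/-- A group of order `12` generated by `x` and `c` with `x ^ 2 = (x * c ^ 2) ^ 3 = 1`
is a group of permutations of four points, unless `⟨x * c ^ 2⟩` is normal. -/
lemma exists_injective_hom_perm (hG : Nat.card G = 12) (ht : (x * (c * c)) ^ 3 = 1)
    (hN : ¬ (Subgroup.zpowers (x * (c * c))).Normal) :
    ∃ φ : G →* Equiv.Perm (Fin 4), Function.Injective φ := by
  set N := Subgroup.zpowers (x * (c * c)) with hNdef
  have h3 : Nat.card N = 3 := by
    rw [hNdef, Nat.card_zpowers]
    refine ((Nat.dvd_prime Nat.prime_three).1 (orderOf_dvd_of_pow_eq_one ht)).resolve_left ?_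
    intro h1
    rw [orderOf_eq_one_iff] at h1
    rw [hNdef, h1, Subgroup.zpowers_one_eq_bot] at hN
    exact hN inferInstance
  have : Finite G := Nat.finite_of_card_ne_zero (by omega)
  have h4 : Nat.card (G ⧸ N) = 4 := by
    have := Subgroup.card_eq_card_quotient_mul_card_subgroup N
    rw [hG, h3] at this
    omega
  have hker : (MulAction.toPermHom G (G ⧸ N)).ker = ⊥ := by
    rw [← Subgroup.normalCore_eq_ker, ← Subgroup.card_eq_one]
    refine ((Nat.dvd_prime Nat.prime_three).1
      (h3 ▸ Subgroup.card_dvd_of_le N.normalCore_le)).resolve_right fun h => hN ?_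
    rw [← Subgroup.eq_of_le_of_card_ge N.normalCore_le (by rw [h, h3])]
    infer_instance
  let e : G ⧸ N ≃ Fin 4 := Finite.equivFinOfCardEq h4
  exact ⟨(Equiv.permCongrHom e).toMonoidHom.comp (MulAction.toPermHom G (G ⧸ N)),
    (Equiv.permCongrHom e).injective.comp ((MonoidHom.ker_eq_bot_iff _).1 hker)⟩

/-- The characterization of the alternating group on four points by a pair of generators. -/
lemma exists_mulEquiv_alternatingGroup (hG : Nat.card G = 12)
    (hgen : Subgroup.closure {x, c} = ⊤) (hx : x * x = 1) (hx1 : x ≠ 1)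
    (ht : (x * (c * c)) ^ 3 = 1) (hH : ∀ H : Subgroup G, H.index = 2 → x ∈ H → c ∈ H) :
    ∃ θ : G ≃* alternatingGroup (Fin 4),
      (θ x : Equiv.Perm (Fin 4)) = doubleSwap ∧ (θ c : Equiv.Perm (Fin 4)) = threeCycle := by
  have hN : ¬ (Subgroup.zpowers (x * (c * c))).Normal := by
    intro hN
    obtain ⟨H, h2, hxH, hcH⟩ := exists_index_two_of_normal hG hgen hx ht hN
    exact hcH (hH H h2 hxH)
  obtain ⟨φ, hφ⟩ := exists_injective_hom_perm hG ht hN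
  have ht1 : x * (c * c) ≠ 1 := by
    intro h1
    rw [h1, Subgroup.zpowers_one_eq_bot] at hN
    exact hN inferInstance
  obtain ⟨ρ, h1, h2⟩ := exists_conj_eq (φ x) (φ c) (by rw [← map_mul, hx, map_one])
    ((map_ne_one_iff φ hφ).2 hx1)
    (by simp only [← map_mul]; rw [← pow_three', ht, map_one])
    (by simp only [← map_mul]; exact (map_ne_one_iff φ hφ).2 ht1)
  let ψ : G →* Equiv.Perm (Fin 4) := (MulAut.conj ρ).toMonoidHom.comp φ
  have hψ : Function.Injective ψ := (MulAut.conj ρ).injective.comp hφ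
  have hmem : ∀ g, ψ g ∈ alternatingGroup (Fin 4) := by
    have : ⊤ ≤ (alternatingGroup (Fin 4)).comap ψ := by
      rw [← hgen, Subgroup.closure_le]
      rintro y (rfl | rfl)
      · change ρ * φ y * ρ⁻¹ ∈ alternatingGroup (Fin 4)
        rw [h1, Equiv.Perm.mem_alternatingGroup]
        decide +kernel
      · change ρ * φ y * ρ⁻¹ ∈ alternatingGroup (Fin 4)
        rw [h2, Equiv.Perm.mem_alternatingGroup]
        decide +kernel
    exact fun g => this (Subgroup.mem_top g)
  have hinj : Function.Injective (ψ.codRestrict _ hmem) := fun a b hab =>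
    hψ (congrArg Subtype.val hab)
  have hbij : Function.Bijective (ψ.codRestrict _ hmem) := by
    refine (Nat.bijective_iff_injective_and_card _).2 ⟨hinj, ?_⟩
    rw [hG, nat_card_alternatingGroup]
    simp [Nat.factorial]
  exact ⟨MulEquiv.ofBijective _ hbij, h1, h2⟩

end

/-! ### The two voltage assignments -/

section

variable {G : Type} [Group G]

/-- The voltages on `typeP`, in terms of two generators. -/
def voltP (x c : G) : Fin 14 → G :=
  ![(x * (c * c))⁻¹, x * (c * c), x * (c * c), x, x, c * c, c * c, c, c, c⁻¹, c⁻¹, (c * c)⁻¹,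
    (c * c)⁻¹, (x * (c * c))⁻¹]

/-- The voltages on `typeQ`, in terms of two generators. -/
def voltQ (x c : G) : Fin 14 → G :=
  ![x * (c * c), (x * (c * c))⁻¹, (x * (c * c))⁻¹, c⁻¹, c⁻¹, c⁻¹ * x, c⁻¹ * x, c, c, x, x, x * c,
    x * c, x * (c * c)]

variable {G' : Type} [Group G']

lemma map_voltP (θ : G →* G') (x c : G) (i : Fin 14) :
    θ (voltP x c i) = voltP (θ x) (θ c) i := by
  fin_cases i <;> simp [voltP]

lemma map_voltQ (θ : G →* G') (x c : G) (i : Fin 14) :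
    θ (voltQ x c i) = voltQ (θ x) (θ c) i := by
  fin_cases i <;> simp [voltQ]

lemma voltP_mem {x c : G} {H : Subgroup G} (hx : x ∈ H) (hc : c ∈ H) (i : Fin 14) :
    voltP x c i ∈ H := by
  have h2 := mul_mem hc hc
  have h3 := mul_mem hx h2
  fin_cases i
  exacts [inv_mem h3, h3, h3, hx, hx, h2, h2, hc, hc, inv_mem hc, inv_mem hc, inv_mem h2,
    inv_mem h2, inv_mem h3]

lemma voltQ_mem {x c : G} {H : Subgroup G} (hx : x ∈ H) (hc : c ∈ H) (i : Fin 14) :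
    voltQ x c i ∈ H := by
  have h2 := mul_mem hc hc
  have h3 := mul_mem hx h2
  have h4 := mul_mem (inv_mem hc) hx
  have h5 := mul_mem hx hc
  fin_cases i
  exacts [h3, inv_mem h3, inv_mem h3, inv_mem hc, inv_mem hc, h4, h4, hc, hc, hx, hx, h5, h5, h3]

lemma voltP_mem_iff {x c : G} {H : Subgroup G} (hH : H.index = 2) (hx : x ∈ H) (hc : c ∉ H)
    (i : Fin 14) : voltP x c i ∈ H ↔ (typeP i).val % 2 ≠ i.val % 2 := by
  fin_cases i <;> simp [voltP, typeP, Subgroup.mul_mem_iff_of_index_two hH, hx, hc,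
    -mul_inv_rev]

lemma voltQ_mem_iff {x c : G} {H : Subgroup G} (hH : H.index = 2) (hx : x ∈ H) (hc : c ∉ H)
    (i : Fin 14) : voltQ x c i ∈ H ↔ (typeQ i).val % 2 ≠ i.val % 2 := by
  fin_cases i <;> simp [voltQ, typeQ, Subgroup.mul_mem_iff_of_index_two hH, hx, hc,
    -mul_inv_rev]

end

/-- A double transposition, as a generator of the alternating group. -/
def genX : alternatingGroup (Fin 4) :=
  ⟨doubleSwap, Equiv.Perm.mem_alternatingGroup.2 (by decide +kernel)⟩

/-- A `3`-cycle, as a generator of the alternating group. -/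
def genC : alternatingGroup (Fin 4) :=
  ⟨threeCycle, Equiv.Perm.mem_alternatingGroup.2 (by decide +kernel)⟩

lemma mem_of_genX_of_genC {H : Subgroup (alternatingGroup (Fin 4))} (hx : genX ∈ H)
    (hc : genC ∈ H) (g : alternatingGroup (Fin 4)) : g ∈ H := by
  have key : ∀ g : alternatingGroup (Fin 4), ∃ i k : Fin 3, ∃ j : Fin 2,
      g = genC ^ i.val * genX ^ j.val * genC ^ k.val := by decide +kernel
  obtain ⟨i, k, j, rfl⟩ := key g
  exact mul_mem (mul_mem (pow_mem hc _) (pow_mem hx _)) (pow_mem hc _)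

namespace CMap

variable {F : Type} [Fintype F] {M : CMap F}

namespace IsDerived

variable {G : Type} [Group G] {p : Fin 14 → Fin 14} {α : Fin 14 → G} {e : G × Fin 14 ≃ F}

lemma ne_one (h : M.IsDerived p α e) {i : Fin 14} (hi : p (rowB i) = i) : α i ≠ 1 := by
  intro h1
  apply M.fpf02 (e (1, i))
  rw [h.s2_apply, h.s0_apply, h.apply_rowB, h1, hi, mul_one]

lemma pow_three_eq_one (h : M.IsDerived p α e) (he : M.Equivelar 3 7) (h0 : p 0 = 1) :
    α 0 ^ 3 = 1 := by
  have := h.mul_mul_eq_one he 0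
  rw [h0, show rowA 1 = 0 from rfl, h0, show rowA 1 = 0 from rfl] at this
  rw [pow_three', this]

lemma eq_voltP (h : M.IsDerived typeP α e) (he : M.Equivelar 3 7) :
    α = voltP (α 3) (α 7) ∧ α 3 * α 3 = 1 ∧ α 3 ≠ 1 ∧ (α 3 * (α 7 * α 7)) ^ 3 = 1 := by
  have b1 : α 2 = α 1 := h.apply_rowB 1
  have b3 : α 4 = α 3 := h.apply_rowB 3
  have b5 : α 6 = α 5 := h.apply_rowB 5
  have b7 : α 8 = α 7 := h.apply_rowB 7
  have b9 : α 10 = α 9 := h.apply_rowB 9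
  have b11 : α 12 = α 11 := h.apply_rowB 11
  have b13 : α 13 = α 0 := (h.apply_rowB 13).symm
  have m0 : α 0 * α 1 = 1 := h.mul_eq_one 0
  have m3 : α 3 * α 4 = 1 := h.mul_eq_one 3
  have m5 : α 5 * α 12 = 1 := h.mul_eq_one 5
  have m7 : α 7 * α 9 = 1 := h.mul_eq_one 7
  have t4 : α 4 * α 2 * α 12 = 1 := h.mul_mul_eq_one he 4
  have t6 : α 6 * α 10 * α 9 = 1 := h.mul_mul_eq_one he 6
  have m0' := h.pow_three_eq_one he rfl
  have x1 : α 3 ≠ 1 := h.ne_one rfl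
  rw [b3] at m3
  have e9 : α 9 = (α 7)⁻¹ := eq_inv_of_mul_eq_one_right m7
  have e5 : α 5 = α 7 * α 7 := by
    rw [b5, b9, e9, mul_assoc, ← mul_inv_rev] at t6
    exact mul_inv_eq_one.1 t6
  have e12 : α 12 = (α 7 * α 7)⁻¹ := by
    rw [eq_inv_of_mul_eq_one_right m5, e5]
  have e1 : α 1 = α 3 * (α 7 * α 7) := by
    rw [b1, b3, e12, mul_inv_eq_one] at t4
    rw [← t4, ← mul_assoc, m3, one_mul]
  have e0 : α 0 = (α 3 * (α 7 * α 7))⁻¹ := by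
    rw [eq_inv_of_mul_eq_one_left m0, e1]
  refine ⟨?_, m3, x1, ?_⟩
  · funext i
    fin_cases i
    exacts [e0, e1, b1.trans e1, rfl, b3, e5, b5.trans e5, rfl, b7, e9, b9.trans e9,
      b11.symm.trans e12, e12, b13.trans e0]
  · rw [e0, inv_pow, inv_eq_one] at m0'
    exact m0'

lemma eq_voltQ (h : M.IsDerived typeQ α e) (he : M.Equivelar 3 7) :
    α = voltQ (α 9) (α 7) ∧ α 9 * α 9 = 1 ∧ α 9 ≠ 1 ∧ (α 9 * (α 7 * α 7)) ^ 3 = 1 := by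
  have b1 : α 2 = α 1 := h.apply_rowB 1
  have b3 : α 4 = α 3 := h.apply_rowB 3
  have b5 : α 6 = α 5 := h.apply_rowB 5
  have b7 : α 8 = α 7 := h.apply_rowB 7
  have b9 : α 10 = α 9 := h.apply_rowB 9
  have b11 : α 12 = α 11 := h.apply_rowB 11
  have b13 : α 13 = α 0 := (h.apply_rowB 13).symm
  have m0 : α 0 * α 1 = 1 := h.mul_eq_one 0
  have m3 : α 3 * α 7 = 1 := h.mul_eq_one 3
  have m5 : α 5 * α 11 = 1 := h.mul_eq_one 5
  have m9 : α 9 * α 10 = 1 := h.mul_eq_one 9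
  have t2 : α 2 * α 12 * α 7 = 1 := h.mul_mul_eq_one he 2
  have t4 : α 4 * α 9 * α 11 = 1 := h.mul_mul_eq_one he 4
  have m0' := h.pow_three_eq_one he rfl
  have x1 : α 9 ≠ 1 := h.ne_one rfl
  rw [b9] at m9
  have ix : (α 9)⁻¹ = α 9 := inv_eq_of_mul_eq_one_left m9
  have e3 : α 3 = (α 7)⁻¹ := eq_inv_of_mul_eq_one_left m3
  have e11 : α 11 = α 9 * α 7 := by
    rw [b3, e3] at t4
    rw [eq_inv_of_mul_eq_one_right t4, mul_inv_rev, inv_inv, ix]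
  have e5 : α 5 = (α 7)⁻¹ * α 9 := by
    rw [eq_inv_of_mul_eq_one_left m5, e11, mul_inv_rev, ix]
  have e1 : α 1 = (α 9 * (α 7 * α 7))⁻¹ := by
    rw [b1, b11, e11, mul_assoc, mul_assoc] at t2
    exact eq_inv_of_mul_eq_one_left t2
  have e0 : α 0 = α 9 * (α 7 * α 7) := by
    rw [eq_inv_of_mul_eq_one_left m0, e1, inv_inv]
  refine ⟨?_, m9, x1, ?_⟩
  · funext i
    fin_cases i
    exacts [e0, e1, b1.trans e1, e3, b3.trans e3, e5, b5.trans e5, rfl, b7, rfl, b9, e11,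
      b11.trans e11, b13.trans e0]
  · rw [← e0]
    exact m0'

end IsDerived

end CMap

/-! ### The two maps -/

/-- Compatibility of voltages `α` with an action `p`, ensuring that the derived map is a map
of type `{3, 7}`. -/
structure IsVoltage {G : Type} [Group G] (p : Fin 14 → Fin 14) (α : Fin 14 → G) : Prop where
  apply_apply : ∀ i, p (p i) = i
  mul_eq_one : ∀ i, α i * α (p i) = 1
  apply_rowB : ∀ i, p (rowB i) = rowB (p i)
  voltage_rowB : ∀ i, α (rowB i) = α i
  apply_ne : ∀ i, p i ≠ i
  ne_one : ∀ i, p (rowB i) = i → α i ≠ 1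
  ne_one' : ∀ i, rowA (p i) = i → α i ≠ 1
  triangle : ∀ i, rowA (p (rowA (p (rowA (p i))))) = i
  mul_mul_eq_one : ∀ i, α i * α (rowA (p i)) * α (rowA (p (rowA (p i)))) = 1
  mem : ∀ H : Subgroup G, (∀ i, α i ∈ H) → ∀ g, g ∈ H

lemma isVoltage_voltP : IsVoltage typeP (voltP genX genC) where
  apply_apply := by decide
  mul_eq_one := by decide +kernel
  apply_rowB := by decide
  voltage_rowB := by decide +kernel
  apply_ne := by decide
  ne_one := by decide +kernel
  ne_one' := by decide +kernel
  triangle := by decide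
  mul_mul_eq_one := by decide +kernel
  mem _ h := mem_of_genX_of_genC (h 3) (h 7)

lemma isVoltage_voltQ : IsVoltage typeQ (voltQ genX genC) where
  apply_apply := by decide
  mul_eq_one := by decide +kernel
  apply_rowB := by decide
  voltage_rowB := by decide +kernel
  apply_ne := by decide
  ne_one := by decide +kernel
  ne_one' := by decide +kernel
  triangle := by decide
  mul_mul_eq_one := by decide +kernel
  mem _ h := mem_of_genX_of_genC (h 9) (h 7)

lemma rowA_rowA : ∀ i, rowA (rowA i) = i := by decide

lemma rowB_rowB : ∀ i, rowB (rowB i) = i := by decide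

lemma Equiv.forall_of_prod {α β γ : Type*} (e : α × β ≃ γ) {P : γ → Prop}
    (h : ∀ a b, P (e (a, b))) (y : γ) : P y := by
  simpa using h (e.symm y).1 (e.symm y).2

lemma row_induction {P : Fin 14 → Prop} (h0 : P 0) (hA : ∀ i, P i → P (rowA i))
    (hB : ∀ i, P i → P (rowB i)) (i : Fin 14) : P i := by
  have hm : ∀ m : ℕ, P ((rowB ∘ rowA)^[m] 0) := fun m => by
    induction m with
    | zero => exact h0
    | succ m ih =>
      rw [Function.iterate_succ_apply']
      exact hB _ (hA _ ih)
  have key : ∀ i : Fin 14, ∃ m : Fin 7,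
      (rowB ∘ rowA)^[m.val] 0 = i ∨ rowA ((rowB ∘ rowA)^[m.val] 0) = i := by decide +kernel
  obtain ⟨m, rfl | rfl⟩ := key i
  exacts [hm m, hA _ (hm m)]

namespace IsVoltage

variable {F : Type} [Fintype F] {G : Type} [Group G] {p : Fin 14 → Fin 14} {α : Fin 14 → G}

lemma forall_equivalence (h : IsVoltage p α) {R : G × Fin 14 → G × Fin 14 → Prop}
    (hR : Equivalence R) (h0 : ∀ g i, R (g, i) (g * α i, p i)) (h1 : ∀ g i, R (g, i) (g, rowA i))
    (h2 : ∀ g i, R (g, i) (g, rowB i)) (x y : G × Fin 14) : R x y := by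
  have hrow : ∀ g i, R (g, 0) (g, i) := fun g =>
    row_induction (hR.refl _) (fun i hi => hR.trans hi (h1 g i)) (fun i hi => hR.trans hi (h2 g i))
  let H : Subgroup G :=
    { carrier := {k | ∀ g, R (g, 0) (g * k, 0)}
      one_mem' := fun g => by simpa using hR.refl _
      mul_mem' := fun {a b} ha hb g => by simpa only [mul_assoc] using hR.trans (ha g) (hb (g * a))
      inv_mem' := fun {a} ha g => hR.symm (by simpa using ha (g * a⁻¹)) }
  have hH : ∀ k, k ∈ H := h.mem H fun i g =>
    hR.trans (hrow g i) (hR.trans (h0 g i) (hR.symm (hrow _ _)))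
  have hx : ∀ x, R (1, 0) x := fun x =>
    hR.trans (by simpa using hH x.1 1) (hrow x.1 x.2)
  exact hR.trans (hR.symm (hx x)) (hx y)

lemma exists_isDerived (h : IsVoltage p α) (e : G × Fin 14 ≃ F) :
    ∃ M : CMap F, M.IsDerived p α e := by
  have inv0 : Function.Involutive fun q : G × Fin 14 => (q.1 * α q.2, p q.2) := by
    rintro ⟨g, i⟩
    simp [mul_assoc, h.mul_eq_one, h.apply_apply]
  have inv1 : Function.Involutive fun q : G × Fin 14 => (q.1, rowA q.2) := by
    rintro ⟨g, i⟩
    simp [rowA_rowA]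
  have inv2 : Function.Involutive fun q : G × Fin 14 => (q.1, rowB q.2) := by
    rintro ⟨g, i⟩
    simp [rowB_rowB]
  have neA : ∀ i, rowA i ≠ i := by decide
  have neB : ∀ i, rowB i ≠ i := by decide
  let s0 := e.permCongr inv0.toPerm
  let s1 := e.permCongr inv1.toPerm
  let s2 := e.permCongr inv2.toPerm
  have e0 : ∀ g i, s0 (e (g, i)) = e (g * α i, p i) := fun g i => by simp [s0]
  have e1 : ∀ g i, s1 (e (g, i)) = e (g, rowA i) := fun g i => by simp [s1]
  have e2 : ∀ g i, s2 (e (g, i)) = e (g, rowB i) := fun g i => by simp [s2]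
  refine ⟨⟨⟨e (1, 0)⟩, s0, s1, s2, Equiv.ext (e.forall_of_prod fun g i => ?_),
    Equiv.ext (e.forall_of_prod fun g i => ?_), Equiv.ext (e.forall_of_prod fun g i => ?_),
    e.forall_of_prod fun g i => ?_, e.forall_of_prod fun g i => ?_, e.forall_of_prod fun g i => ?_,
    Equiv.ext (e.forall_of_prod fun g i => ?_), e.forall_of_prod fun g i => ?_, fun x y => ?_⟩,
    e0, e1, e2⟩
  · simp [e0, mul_assoc, h.mul_eq_one, h.apply_apply]
  · simp [e1, rowA_rowA]
  · simp [e2, rowB_rowB]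
  · simp [e0, h.apply_ne]
  · simp [e1, neA]
  · simp [e2, neB]
  · simp [e0, e2, mul_assoc, h.mul_eq_one, h.apply_apply, h.apply_rowB, h.voltage_rowB, rowB_rowB]
  · rw [e2, e0, h.voltage_rowB, ne_eq, e.apply_eq_iff_eq, Prod.mk.injEq, mul_eq_left]
    exact fun hi => h.ne_one i hi.2 hi.1
  · have := h.forall_equivalence
      (R := fun x y => ∃ g ∈ Subgroup.closure {s0, s1, s2}, g (e x) = e y) ⟨fun x => ⟨1, one_mem _, rfl⟩, ?_, ?_⟩ (fun g i => ⟨s0, ?_, e0 g i⟩)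
      (fun g i => ⟨s1, ?_, e1 g i⟩) (fun g i => ⟨s2, ?_, e2 g i⟩) (e.symm x) (e.symm y)
    · simpa using this
    · rintro x y ⟨g, hg, hgx⟩
      exact ⟨g⁻¹, inv_mem hg, by simp [← hgx]⟩
    · rintro x y z ⟨g, hg, hgx⟩ ⟨k, hk, hky⟩
      exact ⟨k * g, mul_mem hk hg, by simp [hgx, hky]⟩
    all_goals exact Subgroup.subset_closure (by simp)

end IsVoltage

namespace CMap

variable {F : Type} [Fintype F] {M : CMap F}

/-- The flag reached from `x` by applying the involutions listed in `w`. -/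
def walk (M : CMap F) (w : List (Fin 3)) (x : F) : F :=
  w.foldl (fun y k => ![M.s0, M.s1, M.s2] k y) x

lemma map_walk {F' : Type} [Fintype F'] {M' : CMap F'} {φ : F → F'}
    (h0 : ∀ x, φ (M.s0 x) = M'.s0 (φ x)) (h1 : ∀ x, φ (M.s1 x) = M'.s1 (φ x))
    (h2 : ∀ x, φ (M.s2 x) = M'.s2 (φ x)) (w : List (Fin 3)) (x : F) :
    φ (M.walk w x) = M'.walk w (φ x) := by
  induction w generalizing x with
  | nil => rfl
  | cons k w ih =>
    rw [walk, walk, List.foldl_cons, List.foldl_cons, ← walk, ← walk, ih]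
    congr 1
    fin_cases k
    exacts [h0 x, h1 x, h2 x]

lemma Equi.walk_eq {x y : F} (h : M.Equi x y) {w : List (Fin 3)} (hw : M.walk w x = x) :
    M.walk w y = y := by
  obtain ⟨g, rfl⟩ := h
  rw [← map_walk (aut_s0 g) (aut_s1 g) (aut_s2 g), hw]

lemma not_orientable_of_walk {w : List (Fin 3)} {x : F} (hw : M.walk w x = x)
    (hodd : w.length % 2 = 1) : ¬ M.Orientable := by
  rintro ⟨A, h0, h1, h2⟩
  have key : ∀ (w : List (Fin 3)) x, M.walk w x ∈ A ↔ (x ∈ A ↔ w.length % 2 = 0) := by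
    intro w
    induction w with
    | nil => simp [walk]
    | cons k w ih =>
      intro x
      rw [walk, List.foldl_cons, ← walk, ih, List.length_cons]
      have : ![M.s0, M.s1, M.s2] k x ∈ A ↔ x ∉ A := by
        fin_cases k
        exacts [h0 x, h1 x, h2 x]
      rw [this]
      by_cases hx : x ∈ A <;> simp only [hx, not_true, not_false_eq_true, true_iff, false_iff] <;>
        omega
  have := key w x
  rw [hw] at this
  have h' : ¬ w.length % 2 = 0 := by omega
  tauto

lemma not_isRegular_and_not_isChiral {f : Fin 3 → F} (h : ∀ i j, M.Equi (f i) (f j) → i = j) :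
    ¬ M.IsRegular ∧ ¬ M.IsChiral := by
  have h3 : 3 ≤ M.numFlagOrbits := by
    rw [numFlagOrbits, ← Nat.card_fin 3]
    refine Nat.card_le_card_of_injective (fun i => (⟨_, f i, rfl⟩ : Set.range M.flagOrbit)) ?_
    intro i j hij
    exact (h j i (flagOrbit_eq_iff.1 (congrArg Subtype.val hij))).symm
  constructor
  · intro h1
    rw [IsRegular, IsKOrbit] at h1
    omega
  · rintro ⟨h2, -⟩
    rw [IsKOrbit] at h2
    omega

namespace IsDerived

variable {G : Type} [Group G] {p : Fin 14 → Fin 14} {α : Fin 14 → G} {e : G × Fin 14 ≃ F}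

/-- Walks in the coordinates of a derived map. -/
def walk (p : Fin 14 → Fin 14) (α : Fin 14 → G) (w : List (Fin 3)) (q : G × Fin 14) :
    G × Fin 14 :=
  w.foldl (fun q k => ![(q.1 * α q.2, p q.2), (q.1, rowA q.2), (q.1, rowB q.2)] k) q

lemma walk_apply (h : M.IsDerived p α e) (w : List (Fin 3)) (q : G × Fin 14) :
    M.walk w (e q) = e (walk p α w q) := by
  induction w generalizing q with
  | nil => rfl
  | cons k w ih =>
    rw [walk, CMap.walk, List.foldl_cons, List.foldl_cons, ← walk, ← CMap.walk, ← ih]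
    congr 1
    fin_cases k
    exacts [h.s0_apply _ _, h.s1_apply _ _, h.s2_apply _ _]

lemma walk_eq_iff (h : M.IsDerived p α e) (w : List (Fin 3)) (q : G × Fin 14) :
    M.walk w (e q) = e q ↔ walk p α w q = q := by
  rw [h.walk_apply, e.apply_eq_iff_eq]

lemma equi (h : M.IsDerived p α e) (g k : G) (i : Fin 14) : M.Equi (e (g, i)) (e (k, i)) := by
  refine ⟨⟨e.permCongr ((Equiv.mulLeft (k * g⁻¹)).prodCongr (Equiv.refl _)),
    M.mem_aut_iff.2 ⟨e.forall_of_prod fun a j => ?_, e.forall_of_prod fun a j => ?_,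
      e.forall_of_prod fun a j => ?_⟩⟩, ?_⟩
  · simp [h.s0_apply, mul_assoc]
  · simp [h.s1_apply]
  · simp [h.s2_apply]
  · simp

lemma vertexTransitive (h : M.IsDerived p α e) : M.VertexTransitive := by
  have hrow : ∀ g i, M.vertexOf (e (g, i)) = M.vertexOf (e (g, 0)) := by
    intro g i
    induction i using row_induction with
    | h0 => rfl
    | hA i hi =>
      rw [← hi, ← h.s1_apply]
      refine MulAction.orbit_eq_iff.2 ⟨⟨M.s1, Subgroup.subset_closure (by simp)⟩, rfl⟩
    | hB i hi =>
      rw [← hi, ← h.s2_apply]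
      refine MulAction.orbit_eq_iff.2 ⟨⟨M.s2, Subgroup.subset_closure (by simp)⟩, rfl⟩
  intro x y
  obtain ⟨⟨g, i⟩, rfl⟩ := e.surjective x
  obtain ⟨⟨k, j⟩, rfl⟩ := e.surjective y
  obtain ⟨a, ha⟩ := h.equi g k i
  exact ⟨a.1, a.2, by rw [ha, hrow, hrow k j]⟩

lemma equivelar (h : M.IsDerived p α e) (hα : IsVoltage p α) : M.Equivelar 3 7 := by
  constructor
  · refine Equiv.Perm.card_orbit_closure_pair_of_prime M.invol0 M.invol1 M.fpf0 M.fpf1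
      Nat.prime_three (Equiv.ext (e.forall_of_prod fun g i => ?_)) (e.forall_of_prod fun g i => ?_)
    · have := hα.mul_mul_eq_one i
      simp only [mul_assoc] at this
      simp [pow_succ, h.s0_apply, h.s1_apply, hα.triangle, mul_assoc, this]
    · rw [h.s0_apply, h.s1_apply, ne_eq, e.apply_eq_iff_eq, Prod.mk.injEq, mul_eq_left]
      exact fun hi => hα.ne_one' i hi.2 hi.1
  · have row : ∀ i, rowB (rowA i) ≠ i ∧ rowB (rowA (rowB (rowA (rowB (rowA (rowB (rowA (rowB (rowA
        (rowB (rowA (rowB (rowA i))))))))))))) = i := by decide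
    refine Equiv.Perm.card_orbit_closure_pair_of_prime M.invol1 M.invol2 M.fpf1 M.fpf2
      (by norm_num) (Equiv.ext (e.forall_of_prod fun g i => ?_)) (e.forall_of_prod fun g i => ?_)
    · simp [pow_succ, h.s1_apply, h.s2_apply, (row i).2]
    · simp [h.s1_apply, h.s2_apply, (row i).1]

end IsDerived

end CMap

namespace CMap

variable {F : Type} [Fintype F] {M : CMap F} {p : Fin 14 → Fin 14}

namespace IsDerived

/-- Closed walks separate flag orbits. -/
lemma not_isRegular_and_not_isChiral {G : Type} [Group G] {α : Fin 14 → G} {e : G × Fin 14 ≃ F}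
    (h : M.IsDerived p α e) (ws : List (List (Fin 3))) (r : Fin 3 → Fin 14)
    (hr : ∀ i j, (∀ w ∈ ws, walk p α w (1, r i) = (1, r i) → walk p α w (1, r j) = (1, r j)) →
      (∀ w ∈ ws, walk p α w (1, r j) = (1, r j) → walk p α w (1, r i) = (1, r i)) → i = j) :
    ¬ M.IsRegular ∧ ¬ M.IsChiral := by
  refine CMap.not_isRegular_and_not_isChiral (f := fun i => e (1, r i)) fun i j hij => ?_
  refine hr i j (fun w _ => ?_) fun w _ => ?_ <;> simp only [← h.walk_eq_iff]
  exacts [hij.walk_eq, hij.symm.walk_eq]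

lemma goodMap {α : Fin 14 → alternatingGroup (Fin 4)} {e : alternatingGroup (Fin 4) × Fin 14 ≃ F}
    (h : M.IsDerived p α e) (hα : IsVoltage p α) (hr : ¬ M.IsRegular ∧ ¬ M.IsChiral) :
    GoodMap M := by
  have he := h.equivelar hα
  refine ⟨h.vertexTransitive, he, ?_, hr⟩
  have h1 := M.euler_mul he
  have h2 := Fintype.card_congr e
  rw [Fintype.card_prod, Fintype.card_fin, ← Nat.card_eq_fintype_card,
    nat_card_alternatingGroup] at h2
  norm_num [Nat.factorial] at h2
  omega

/-- The uniqueness of derived maps with a group of order `12` generated by two elements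
satisfying the relations of the alternating group. -/
lemma isomorphic_of_relations {F' : Type} [Fintype F'] {M' : CMap F'} {G : Type} [Group G]
    {α : Fin 14 → G} {e : G × Fin 14 ≃ F} (h : M.IsDerived p α e) (hG : Nat.card G = 12)
    (V : ∀ {G : Type} [Group G], G → G → Fin 14 → G)
    (hmap : ∀ {G G' : Type} [Group G] [Group G'] (θ : G →* G') (x c : G) (i : Fin 14),
      θ (V x c i) = V (θ x) (θ c) i)
    (hmem : ∀ {x c : G} {H : Subgroup G}, x ∈ H → c ∈ H → ∀ i, V x c i ∈ H)
    (hiff : ∀ {x c : G} {H : Subgroup G}, H.index = 2 → x ∈ H → c ∉ H →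
      ∀ i, V x c i ∈ H ↔ (p i).val % 2 ≠ i.val % 2)
    {e' : alternatingGroup (Fin 4) × Fin 14 ≃ F'} (h' : M'.IsDerived p (V genX genC) e')
    {x c : G} (hα : α = V x c ∧ x * x = 1 ∧ x ≠ 1 ∧ (x * (c * c)) ^ 3 = 1)
    (ho : ¬ M.Orientable) : M.Isomorphic M' := by
  obtain ⟨rfl, hx, hx1, ht⟩ := hα
  obtain ⟨θ, hθx, hθc⟩ := exists_mulEquiv_alternatingGroup hG
    (h.closure_eq_top
      (hmem (Subgroup.subset_closure (by simp)) (Subgroup.subset_closure (by simp))))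
    hx hx1 ht (fun H h2 hxH => by_contra fun hcH => ho <|
      h.orientable (fun a b => Subgroup.mul_mem_iff_of_index_two h2) (hiff h2 hxH hcH))
  refine h.isomorphic h' θ fun i => ?_
  rw [← show θ x = genX from Subtype.ext hθx, ← show θ c = genC from Subtype.ext hθc]
  exact hmap θ.toMonoidHom x c i

end IsDerived

lemma isomorphic_or_isomorphic {F' : Type} [Fintype F'] {P Q : CMap F'}
    {e : alternatingGroup (Fin 4) × Fin 14 ≃ F'} (hP : P.IsDerived typeP (voltP genX genC) e)
    (hQ : Q.IsDerived typeQ (voltQ genX genC) e) (hM : GoodMap M) (ho : ¬ M.Orientable) :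
    M.Isomorphic P ∨ M.Isomorphic Q := by
  obtain ⟨hv, he, hχ, hr, hc⟩ := hM
  obtain ⟨f, p, hf, hp, hcases⟩ := IsChart.exists_type he hv hr hc
  obtain ⟨α, e, h⟩ := hf.exists_isDerived hv (fun i j => hf.eq_of_equi he hv hr hc) hp
  have hG : Nat.card M.aut = 12 := by
    have h1 := M.euler_mul he
    have h2 := Nat.card_congr e
    rw [Nat.card_prod, Nat.card_fin, Nat.card_eq_fintype_card (α := F)] at h2
    omega
  rcases hcases with hodd | rfl | rfl
  · exact absurd (h.orientable (H := ⊤) (by simp) (by simpa using hodd)) ho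
  · exact Or.inl (h.isomorphic_of_relations hG voltP map_voltP voltP_mem voltP_mem_iff hP
      (h.eq_voltP he) ho)
  · exact Or.inr (h.isomorphic_of_relations hG voltQ map_voltQ voltQ_mem voltQ_mem_iff hQ
      (h.eq_voltQ he) ho)

lemma not_isomorphic {F' : Type} [Fintype F'] {N : CMap F'} {G : Type} [Group G] {α : Fin 14 → G}
    {e : G × Fin 14 ≃ F'} (h : N.IsDerived p α e) {w : List (Fin 3)} {x : F}
    (hw : M.walk w x = x) (hN : ∀ i, IsDerived.walk p α w (1, i) ≠ (1, i)) :
    ¬ M.Isomorphic N := by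
  rintro ⟨φ, h0, h1, h2⟩
  have hφ := map_walk h0 h1 h2 w x
  rw [hw] at hφ
  obtain ⟨⟨g, i⟩, hgi⟩ := e.surjective (φ x)
  rw [← hgi] at hφ
  exact hN i ((h.walk_eq_iff w _).1 ((h.equi g 1 i).walk_eq hφ.symm))

end CMap
/-- Up to isomorphism there are exactly `2` non-orientable
vertex-transitive equivelar maps of Schläfli type `{3, 7}` with Euler
characteristic `-2` that are neither regular nor chiral. -/
theorem stmt_18 :
    ∃ Ms : Fin 2 → CMap (Fin 168),
      (∀ i, GoodMap (Ms i) ∧ ¬ (Ms i).Orientable) ∧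
      (∀ i j, (Ms i).Isomorphic (Ms j) → i = j) ∧
      (∀ (F : Type) [Fintype F] (M : CMap F), GoodMap M → ¬ M.Orientable →
        ∃ i, M.Isomorphic (Ms i)) := by
  have hcard : Nat.card (alternatingGroup (Fin 4) × Fin 14) = 168 := by
    rw [Nat.card_prod, nat_card_alternatingGroup]
    simp [Nat.factorial]
  let e := Finite.equivFinOfCardEq hcard
  obtain ⟨P, hP⟩ := isVoltage_voltP.exists_isDerived e
  obtain ⟨Q, hQ⟩ := isVoltage_voltQ.exists_isDerived e
  have wP := (hP.walk_eq_iff [0, 1, 0, 2, 1, 0, 2, 1, 2] (1, 7)).2 (by decide +kernel)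
  have wQ := (hQ.walk_eq_iff [0, 1, 2, 1, 0, 2, 1, 2, 1, 0, 2, 1, 2, 1, 2] (1, 3)).2
    (by decide +kernel)
  have gP : GoodMap P := hP.goodMap isVoltage_voltP (hP.not_isRegular_and_not_isChiral
    [[0, 1, 0, 2, 1, 0, 2, 1, 2], [0, 2, 1, 0, 2, 1, 0, 2, 1]] ![7, 8, 0] (by decide +kernel))
  have gQ : GoodMap Q := hQ.goodMap isVoltage_voltQ (hQ.not_isRegular_and_not_isChiral
    [[0, 1, 2, 1, 0, 2, 1, 2, 1, 0, 2, 1, 2, 1, 2], [0, 2, 1, 2, 1, 0, 2, 1, 2, 1, 0, 2, 1, 2, 1]]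
    ![3, 4, 0] (by decide +kernel))
  have hPQ : ¬ P.Isomorphic Q := CMap.not_isomorphic hQ wP (by decide +kernel)
  have symm : Q.Isomorphic P → P.Isomorphic Q := by
    rintro ⟨φ, h0, h1, h2⟩
    exact ⟨φ.symm, fun x => by simp [φ.symm_apply_eq, h0], fun x => by simp [φ.symm_apply_eq, h1],
      fun x => by simp [φ.symm_apply_eq, h2]⟩
  refine ⟨![P, Q], ?_, ?_, ?_⟩
  · intro i
    fin_cases i
    exacts [⟨gP, CMap.not_orientable_of_walk wP rfl⟩, ⟨gQ, CMap.not_orientable_of_walk wQ rfl⟩]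
  · intro i j hij
    fin_cases i <;> fin_cases j
    exacts [rfl, absurd hij hPQ, absurd (symm hij) hPQ, rfl]
  · intro F _ M hM ho
    exact (CMap.isomorphic_or_isomorphic hP hQ hM ho).elim (⟨0, ·⟩) (⟨1, ·⟩)
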